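/- arXiv:2205.14291 — 2 statements merged into one kernel-verified Lean document; each statement's English description precedes it below -/
import Mathlib

section
/- There exist constants α ∈ (0,1) and C > 0 depending only on n with the following property: if u is continuous on B₁⁺ ∪ T₁, twice continuously differentiable on B₁⁺ with Δu = 1 on B₁⁺, u = 0 on T₁, and |u| ≤ M on B₁⁺ for some M ≥ 0, then there exist real constants a₁, …, aₙ and b, with 2·aₙ = 1, such that the polynomial P(x) = Σ_{i=1}^{n} aᵢ·xᵢ·xₙ + b·xₙ satisfies |u(x) − P(x)| ≤ C·|x|^{2+α}·(M + 1) for every x ∈ B₁⸝₂⁺. -/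
noncomputable section

/-- The Laplacian of `u : ℝⁿ → ℝ`. -/
def lapl {m : ℕ} (u : EuclideanSpace ℝ (Fin m) → ℝ) (x : EuclideanSpace ℝ (Fin m)) : ℝ :=
  ∑ i : Fin m, fderiv ℝ (fun y => fderiv ℝ u y (EuclideanSpace.single i 1)) x
    (EuclideanSpace.single i 1)

/-- Harmonic on an open set: C² with vanishing Laplacian. -/
def IsHarmonicOn {m : ℕ} (u : EuclideanSpace ℝ (Fin m) → ℝ)
    (U : Set (EuclideanSpace ℝ (Fin m))) : Prop :=
  ContDiffOn ℝ 2 u U ∧ ∀ x ∈ U, lapl u x = 0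

/-- The unit vector `eₙ` in dimension `n + 2`. -/
def en (n : ℕ) : EuclideanSpace ℝ (Fin (n + 2)) := EuclideanSpace.single (Fin.last (n + 1)) 1

/-- The upper half ball `B_r⁺`. -/
def halfBall (n : ℕ) (r : ℝ) : Set (EuclideanSpace ℝ (Fin (n + 2))) :=
  {x | ‖x‖ < r ∧ 0 < x (Fin.last (n + 1))}

/-- The flat boundary part `T_r`. -/
def flatT (n : ℕ) (r : ℝ) : Set (EuclideanSpace ℝ (Fin (n + 2))) :=
  {x | ‖x‖ < r ∧ x (Fin.last (n + 1)) = 0}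

open InnerProductSpace Filter Topology Laplacian

section Calculus

variable {V : Type*} [NormedAddCommGroup V] [InnerProductSpace ℝ V]

lemma hasDerivAt_comp_line {f : V → ℝ} {x e : V} {s : ℝ}
    (hf : DifferentiableAt ℝ f (x + s • e)) :
    HasDerivAt (fun s : ℝ => f (x + s • e)) (fderiv ℝ f (x + s • e) e) s := by
  have h : HasDerivAt (fun s : ℝ => x + s • e) e s := by
    simpa using ((hasDerivAt_id s).smul_const e).const_add x
  exact hf.hasFDerivAt.comp_hasDerivAt s h

lemma eventually_line {p : V → Prop} {x : V} (e : V) (h : ∀ᶠ y in 𝓝 x, p y) :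
    ∀ᶠ s : ℝ in 𝓝 0, p (x + s • e) := by
  have hc : ContinuousAt (fun s : ℝ => x + s • e) 0 := by fun_prop
  exact hc.tendsto.eventually (by simpa using h)

lemma hasDerivAt_deriv_comp_line {f : V → ℝ} {x : V} (hf : ContDiffAt ℝ 2 f x) (e : V) :
    HasDerivAt (deriv fun s : ℝ => f (x + s • e)) (iteratedFDeriv ℝ 2 f x ![e, e]) 0 := by
  have h1 : ∀ᶠ s : ℝ in 𝓝 0, ContDiffAt ℝ 2 f (x + s • e) :=
    eventually_line e (hf.eventually (by simp))
  have h2 : (deriv fun s : ℝ => f (x + s • e)) =ᶠ[𝓝 0] fun s => fderiv ℝ f (x + s • e) e := by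
    filter_upwards [h1] with s hs
    exact (hasDerivAt_comp_line (hs.differentiableAt (by simp))).deriv
  refine HasDerivAt.congr_of_eventuallyEq ?_ h2
  have h3 : DifferentiableAt ℝ (fderiv ℝ f) x :=
    (hf.fderiv_right (m := 1) (by norm_num)).differentiableAt (by simp)
  have h4 : HasFDerivAt (fun y => fderiv ℝ f y e) ((fderiv ℝ (fderiv ℝ f) x).flip e) x := by
    have := h3.hasFDerivAt.clm_apply (hasFDerivAt_const e x)
    simpa using this
  have h5 : HasDerivAt (fun s : ℝ => x + s • e) e 0 := by
    simpa using ((hasDerivAt_id (0 : ℝ)).smul_const e).const_add x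
  rw [iteratedFDeriv_two_apply]
  exact HasFDerivAt.comp_hasDerivAt_of_eq 0 h4 h5 (by simp)

lemma iteratedFDeriv_two_of_quadratic {f : V → ℝ} {x e : V} (hf : ContDiffAt ℝ 2 f x)
    {a b q : ℝ} (h : ∀ s : ℝ, f (x + s • e) = a + b * s + q * s ^ 2) :
    iteratedFDeriv ℝ 2 f x ![e, e] = 2 * q := by
  have h1 := hasDerivAt_deriv_comp_line hf e
  have h2 : (deriv fun s : ℝ => f (x + s • e)) = fun s => b + 2 * q * s := by
    funext s
    have : HasDerivAt (fun s : ℝ => a + b * s + q * s ^ 2) (b + 2 * q * s) s := by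
      have h1 := (((hasDerivAt_id' s).const_mul b).const_add a).add
        (((hasDerivAt_id' s).fun_pow 2).const_mul q)
      exact h1.congr_deriv (by norm_num; ring)
    simpa only [h] using this.deriv
  rw [h2] at h1
  have h3 : HasDerivAt (fun s : ℝ => b + 2 * q * s) (2 * q) 0 := by
    simpa using ((hasDerivAt_id (0 : ℝ)).const_mul (2 * q)).const_add b
  exact h1.unique h3

lemma IsLocalMax.deriv_deriv_nonpos {g : ℝ → ℝ} {t : ℝ} (h : IsLocalMax g t)
    (hc : ContinuousAt g t) : deriv (deriv g) t ≤ 0 := by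
  by_contra! hpos
  have hmin : IsLocalMin g t := isLocalMin_of_deriv_deriv_pos hpos h.deriv_eq_zero hc
  have heq : g =ᶠ[𝓝 t] fun _ => g t := by
    filter_upwards [h, hmin] with s h1 h2 using le_antisymm h1 h2
  have h2 := heq.deriv.deriv_eq
  simp at h2
  linarith

lemma IsLocalMax.laplacian_nonpos [FiniteDimensional ℝ V] {f : V → ℝ} {x : V}
    (h : IsLocalMax f x) (hf : ContDiffAt ℝ 2 f x) : Δ f x ≤ 0 := by
  rw [laplacian_eq_iteratedFDeriv_stdOrthonormalBasis]
  refine Finset.sum_nonpos fun i _ => ?_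
  rw [← (hasDerivAt_deriv_comp_line hf _).deriv]
  have hc : ContinuousAt (fun s : ℝ => f (x + s • stdOrthonormalBasis ℝ V i)) 0 :=
    ContinuousAt.comp (f := fun s : ℝ => x + s • stdOrthonormalBasis ℝ V i)
      (by simpa using hf.continuousAt) (by fun_prop)
  refine IsLocalMax.deriv_deriv_nonpos ?_ hc
  simpa [IsLocalMax, IsMaxFilter] using eventually_line (stdOrthonormalBasis ℝ V i) h

lemma InnerProductSpace.HarmonicAt.comp_isometry_add [FiniteDimensional ℝ V] {f : V → ℝ} {x : V}
    (A : V ≃ₗᵢ[ℝ] V) (c : V) (hf : HarmonicAt f (A x + c)) :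
    HarmonicAt (fun y => f (A y + c)) x := by
  have hA : ContDiff ℝ 2 fun y => A y + c := A.contDiff.add contDiff_const
  refine ⟨hf.1.comp x hA.contDiffAt, ?_⟩
  have h1 : ∀ᶠ y in 𝓝 x, HarmonicAt f (A y + c) :=
    hA.continuous.continuousAt.eventually hf.eventually
  filter_upwards [h1] with y hy
  have h2 := hy.2.self_of_nhds
  have h3 : ContDiffAt ℝ 2 (fun y => f (A y + c)) y := hy.1.comp y hA.contDiffAt
  rw [laplacian_eq_iteratedFDeriv_orthonormalBasis _ ((stdOrthonormalBasis ℝ V).map A)] at h2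
  rw [laplacian_eq_iteratedFDeriv_stdOrthonormalBasis]
  simp only [Pi.zero_apply] at h2 ⊢
  rw [← h2]
  refine Finset.sum_congr rfl fun i _ => ?_
  rw [← (hasDerivAt_deriv_comp_line h3 _).deriv, ← (hasDerivAt_deriv_comp_line hy.1 _).deriv]
  congr 2
  funext s
  simp [add_right_comm]

end Calculus

section HalfSpace

variable {n : ℕ}

local notation "𝔼" => EuclideanSpace ℝ (Fin (n + 2))
local notation "last" => Fin.last (n + 1)

/-- A quadratic with Laplacian `-2`, used as a barrier on the half ball with centre `p` and
inner normal `e`. -/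
def barrier (p e : 𝔼) (c : ℝ) (y : 𝔼) : ℝ :=
  ‖y - p‖ ^ 2 - (n + 3) * (inner ℝ (y - p) e) ^ 2 + c * inner ℝ (y - p) e

lemma contDiff_barrier (p e : 𝔼) (c : ℝ) : ContDiff ℝ 2 (barrier p e c) := by
  have h1 : ContDiff ℝ 2 (fun y : 𝔼 => y - p) := contDiff_id.sub contDiff_const
  have h2 : ContDiff ℝ 2 (fun y : 𝔼 => inner ℝ (y - p) e) := h1.inner ℝ contDiff_const
  exact ((h1.norm_sq ℝ).sub (contDiff_const.mul (h2.pow 2))).add (contDiff_const.mul h2)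

lemma laplacian_barrier (p e : 𝔼) (he : ‖e‖ = 1) (c : ℝ) (x : 𝔼) :
    Δ (barrier p e c) x = -2 := by
  rw [laplacian_eq_iteratedFDeriv_orthonormalBasis _ (EuclideanSpace.basisFun (Fin (n + 2)) ℝ)]
  have key : ∀ i : Fin (n + 2), iteratedFDeriv ℝ 2 (barrier p e c) x
      ![EuclideanSpace.basisFun (Fin (n + 2)) ℝ i, EuclideanSpace.basisFun (Fin (n + 2)) ℝ i]
      = 2 * (1 - (n + 3) * (e i) ^ 2) := by
    intro i
    have hi : ‖EuclideanSpace.basisFun (Fin (n + 2)) ℝ i‖ = 1 := by simp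
    have hie : inner ℝ (EuclideanSpace.basisFun (Fin (n + 2)) ℝ i) e = e i := by
      simp [EuclideanSpace.inner_single_left]
    generalize EuclideanSpace.basisFun (Fin (n + 2)) ℝ i = b at hi hie
    refine iteratedFDeriv_two_of_quadratic (contDiff_barrier p e c).contDiffAt
      (a := ‖x - p‖ ^ 2 - (n + 3) * (inner ℝ (x - p) e) ^ 2 + c * inner ℝ (x - p) e)
      (b := 2 * inner ℝ (x - p) b - (n + 3) * (2 * inner ℝ (x - p) e * e i) + c * e i) fun s => ?_
    rw [barrier, show x + s • b - p = (x - p) + s • b by abel, norm_add_sq_real, inner_add_left,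
      inner_smul_right, inner_smul_left, norm_smul, hi, hie]
    simp only [Real.norm_eq_abs, mul_one, sq_abs, conj_trivial]
    ring
  simp only [key]
  have hsum : ∑ i, e i ^ 2 = 1 := by
    rw [← EuclideanSpace.real_norm_sq_eq, he, one_pow]
  rw [← Finset.mul_sum, Finset.sum_sub_distrib, ← Finset.mul_sum, hsum]
  simp
  ring

lemma le_barrier {w : 𝔼 → ℝ} {p e : 𝔼} {δ M : ℝ} (hδ : 0 < δ) (hM : 0 < M) (he : ‖e‖ = 1)
    (hc : ContinuousOn w {y | ‖y - p‖ ≤ δ ∧ 0 ≤ inner ℝ (y - p) e ∧ 0 ≤ y last})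
    (hh : ∀ y, ‖y - p‖ < δ → 0 < inner ℝ (y - p) e → 0 < y last → HarmonicAt w y)
    (hb : ∀ y, ‖y - p‖ ≤ δ → 0 ≤ y last → w y ≤ M)
    (h0 : ∀ y, ‖y - p‖ ≤ δ → 0 ≤ y last → inner ℝ (y - p) e = 0 → w y ≤ 0)
    (h1 : ∀ y, ‖y - p‖ ≤ δ → y last = 0 → w y ≤ 0)
    {x : 𝔼} (hx : ‖x - p‖ ≤ δ) (hxe : 0 ≤ inner ℝ (x - p) e) (hxl : 0 ≤ x last) :
    w x ≤ M / δ ^ 2 * barrier p e ((n + 3) * δ) x := by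
  set D : Set 𝔼 := {y | ‖y - p‖ ≤ δ ∧ 0 ≤ inner ℝ (y - p) e ∧ 0 ≤ y last} with hD
  set ψ : 𝔼 → ℝ := barrier p e ((n + 3) * δ) with hψ
  have hψs : ContDiff ℝ 2 ψ := contDiff_barrier p e _
  have hle : ∀ y, ‖y - p‖ ≤ δ → inner ℝ (y - p) e ≤ δ := fun y hy =>
    (real_inner_le_norm _ _).trans (by rw [he, mul_one]; exact hy)
  have hψlow : ∀ y ∈ D, ‖y - p‖ ^ 2 ≤ ψ y := by
    rintro y ⟨hy1, hy2, -⟩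
    have h3 := hle y hy1
    have : 0 ≤ ((n : ℝ) + 3) * (inner ℝ (y - p) e * (δ - inner ℝ (y - p) e)) := by
      have := sub_nonneg.2 h3
      positivity
    simp only [hψ, barrier]
    nlinarith
  have hnorm : Continuous fun y : 𝔼 => ‖y - p‖ := by fun_prop
  have hinner : Continuous fun y : 𝔼 => inner ℝ (y - p) e :=
    (continuous_id.sub continuous_const).inner continuous_const
  have hlast : Continuous fun y : 𝔼 => y last := by fun_prop
  have hcl : IsClosed D := by
    exact (isClosed_le hnorm continuous_const).inter
      ((isClosed_le continuous_const hinner).inter (isClosed_le continuous_const hlast))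
  have hbd : D ⊆ Metric.closedBall p δ := fun y hy => by
    rw [Metric.mem_closedBall, dist_eq_norm]; exact hy.1
  have hcpt : IsCompact D := (isCompact_closedBall p δ).of_isClosed_subset hcl hbd
  obtain ⟨z, hz, hmax⟩ := hcpt.exists_isMaxOn (f := w - (M / δ ^ 2) • ψ) ⟨x, hx, hxe, hxl⟩
    (hc.sub (hψs.continuous.continuousOn.const_smul _))
  suffices hs : w z - M / δ ^ 2 * ψ z ≤ 0 by
    have h2 : w x - M / δ ^ 2 * ψ x ≤ w z - M / δ ^ 2 * ψ z := hmax ⟨hx, hxe, hxl⟩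
    linarith
  have hMδ : 0 < M / δ ^ 2 := by positivity
  have hψ0 : 0 ≤ M / δ ^ 2 * ψ z := mul_nonneg hMδ.le ((sq_nonneg _).trans (hψlow z hz))
  obtain ⟨hz1, hz2, hz3⟩ := hz
  rcases hz2.eq_or_lt with h | hz2'
  · linarith [h0 z hz1 hz3 h.symm]
  rcases hz3.eq_or_lt with h | hz3'
  · linarith [h1 z hz1 h.symm]
  rcases hz1.eq_or_lt with h | hz1'
  · have h4 := hψlow z ⟨hz1, hz2, hz3⟩
    rw [h] at h4
    have h5 : M ≤ M / δ ^ 2 * ψ z := by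
      calc M = M / δ ^ 2 * δ ^ 2 := by field_simp
        _ ≤ _ := by gcongr
    linarith [hb z hz1 hz3]
  exfalso
  have hnhds : D ∈ 𝓝 z := by
    have ho : IsOpen {y : 𝔼 | ‖y - p‖ < δ ∧ 0 < inner ℝ (y - p) e ∧ 0 < y last} := by
      exact (isOpen_lt hnorm continuous_const).inter
        ((isOpen_lt continuous_const hinner).inter (isOpen_lt continuous_const hlast))
    exact Filter.mem_of_superset (ho.mem_nhds ⟨hz1', hz2', hz3'⟩)
      fun y hy => ⟨hy.1.le, hy.2.1.le, hy.2.2.le⟩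
  have hw := hh z hz1' hz2' hz3'
  have hloc := (hmax.isLocalMax hnhds).laplacian_nonpos
    (hw.1.sub (contDiffAt_const.smul hψs.contDiffAt))
  have hsub := hw.1.laplacian_sub (f₂ := (M / δ ^ 2) • ψ) (contDiffAt_const.smul hψs.contDiffAt)
  rw [laplacian_smul _ hψs.contDiffAt, hw.2.self_of_nhds, hψ, laplacian_barrier p e he] at hsub
  simp only [Pi.zero_apply, smul_eq_mul] at hsub
  linarith

lemma norm_en : ‖en n‖ = 1 := by simp [en]

lemma en_last : en n last = 1 := by simp [en]

lemma inner_en (y : 𝔼) : inner ℝ y (en n) = y last := by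
  simp [en, EuclideanSpace.inner_single_right]

lemma barrier_add_smul_le {p e : 𝔼} {δ s : ℝ} (he : ‖e‖ = 1) :
    barrier p e ((n + 3) * δ) (p + s • e) ≤ (n + 3) * δ * s := by
  have h : inner ℝ (s • e) e = s := by
    rw [inner_smul_left, real_inner_self_eq_norm_sq, he]; simp
  rw [barrier, add_sub_cancel_left, h, norm_smul, he, mul_one, Real.norm_eq_abs, sq_abs]
  nlinarith [mul_nonneg (Nat.cast_nonneg (α := ℝ) n) (sq_nonneg s), sq_nonneg s]

lemma isOpen_halfBall (r : ℝ) : IsOpen (halfBall n r) := by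
  have h1 : Continuous fun y : 𝔼 => ‖y‖ := continuous_norm
  have h2 : Continuous fun y : 𝔼 => y last := by fun_prop
  exact (isOpen_lt h1 continuous_const).inter (isOpen_lt continuous_const h2)

lemma mem_halfBall_union_flatT {r : ℝ} {x : 𝔼} :
    x ∈ halfBall n r ∪ flatT n r ↔ ‖x‖ < r ∧ 0 ≤ x last := by
  simp only [halfBall, flatT, Set.mem_union, Set.mem_ofPred_eq, le_iff_lt_or_eq]
  grind

/-- `v` is harmonic in the half ball of radius `r`, continuous up to the flat boundary part,
vanishes there, and is bounded by `M`. -/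
structure HarmonicDirichlet (r M : ℝ) (v : 𝔼 → ℝ) : Prop where
  cont : ContinuousOn v (halfBall n r ∪ flatT n r)
  harm : ∀ x ∈ halfBall n r, HarmonicAt v x
  zero : ∀ x ∈ flatT n r, v x = 0
  bound : ∀ x ∈ halfBall n r, |v x| ≤ M

namespace HarmonicDirichlet

variable {r M : ℝ} {v : EuclideanSpace ℝ (Fin (n + 2)) → ℝ}

lemma neg (h : HarmonicDirichlet r M v) : HarmonicDirichlet r M (-v) where
  cont := h.cont.neg
  harm x hx := (h.harm x hx).neg
  zero x hx := by simp [h.zero x hx]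
  bound x hx := by simpa using h.bound x hx

lemma zero' (h : HarmonicDirichlet r M v) {x : 𝔼} (hx : ‖x‖ < r) (hl : x last = 0) : v x = 0 :=
  h.zero x ⟨hx, hl⟩

lemma bound' (h : HarmonicDirichlet r M v) (hM : 0 ≤ M) {x : 𝔼} (hx : ‖x‖ < r)
    (hl : 0 ≤ x last) : |v x| ≤ M := by
  rcases hl.eq_or_lt with hl | hl
  · simpa [h.zero' hx hl.symm] using hM
  · exact h.bound x ⟨hx, hl⟩

lemma le_normal (h : HarmonicDirichlet r M v) (hM : 0 < M) {δ : ℝ} (hδ : 0 < δ)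
    {x : 𝔼} (hx : ‖x‖ < r - δ) (hl : 0 < x last) : v x ≤ M * ((n + 3) / δ) * x last := by
  rcases le_or_gt (x last) δ with hxδ | hxδ
  · set p : 𝔼 := x - x last • en n with hp
    have hpl : p last = 0 := by simp [hp, en_last]
    have hpx : x = p + x last • en n := by simp [hp]
    have hpn : ‖p‖ ≤ ‖x‖ := by
      have h1 : ‖x‖ ^ 2 = ‖p‖ ^ 2 + 2 * inner ℝ p (x last • en n) + ‖x last • en n‖ ^ 2 := by
        rw [← norm_add_sq_real, ← hpx]
      rw [inner_smul_right, inner_en, hpl] at h1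
      exact abs_le_of_sq_le_sq' (by nlinarith [sq_nonneg ‖x last • en n‖]) (norm_nonneg _) |>.2
    have hball : ∀ y : 𝔼, ‖y - p‖ ≤ δ → ‖y‖ < r := fun y hy => by
      linarith [norm_le_norm_add_norm_sub' y p]
    have hyl : ∀ y : 𝔼, inner ℝ (y - p) (en n) = y last := fun y => by
      rw [inner_en]; simp [hpl]
    have hxp : x - p = x last • en n := by simp [hp]
    have := le_barrier (w := v) (p := p) (e := en n) hδ hM norm_en
      (h.cont.mono fun y hy => mem_halfBall_union_flatT.2 ⟨hball y hy.1, hy.2.2⟩)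
      (fun y hy _ hl => h.harm y ⟨hball y hy.le, hl⟩)
      (fun y hy hl => (le_abs_self _).trans (h.bound' hM.le (hball y hy) hl))
      (fun y hy hl h0 => (h.zero' (hball y hy) (by rw [← hyl, h0])).le)
      (fun y hy hl => (h.zero' (hball y hy) hl).le)
      (x := x) (by rw [hxp, norm_smul, norm_en, Real.norm_eq_abs, abs_of_pos hl, mul_one]
                   exact hxδ)
      (by rw [hyl]; exact hl.le) hl.le
    refine this.trans ?_
    have h2 := barrier_add_smul_le (p := p) (δ := δ) (s := x last) (norm_en (n := n))
    rw [← hpx] at h2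
    calc _ ≤ M / δ ^ 2 * ((n + 3) * δ * x last) := by gcongr
      _ = _ := by field_simp
  · calc v x ≤ M := (le_abs_self _).trans (h.bound' hM.le (by linarith) hl.le)
      _ = M * (1 / δ) * δ := by field_simp
      _ ≤ _ := by gcongr; linarith [Nat.cast_nonneg (α := ℝ) n]

lemma abs_le_normal (h : HarmonicDirichlet r M v) (hM : 0 < M) {δ : ℝ} (hδ : 0 < δ)
    {x : 𝔼} (hx : ‖x‖ < r - δ) (hl : 0 < x last) : |v x| ≤ M * ((n + 3) / δ) * x last := by
  have h1 := h.neg.le_normal hM hδ hx hl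
  exact abs_le.2 ⟨by simp only [Pi.neg_apply] at h1; linarith, h.le_normal hM hδ hx hl⟩

lemma sub_le_tangential (h : HarmonicDirichlet r M v) (hM : 0 < M) {δ : ℝ} (hδ : 0 < δ)
    {z : 𝔼} (hz : z last = 0) (hz0 : z ≠ 0) (hzδ : ‖z‖ ≤ δ)
    {x : 𝔼} (hx : ‖x‖ < r - 2 * δ) (hl : 0 ≤ x last) :
    v (x + z) - v x ≤ M * ((n + 3) / δ) * ‖z‖ := by
  have hzn : 0 < ‖z‖ := norm_pos_iff.2 hz0
  set e : 𝔼 := ‖z‖⁻¹ • z with he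
  have hen : ‖e‖ = 1 := by rw [he, norm_smul, norm_inv, norm_norm, inv_mul_cancel₀ hzn.ne']
  have hel : e last = 0 := by simp [he, hz]
  have hze : z = ‖z‖ • e := by rw [he, smul_smul, mul_inv_cancel₀ hzn.ne', one_smul]
  set p : 𝔼 := x + (‖z‖ / 2) • e with hp
  have hpl : p last = x last := by simp [hp, hel]
  have hpn : ‖p‖ < r - δ := by
    have := norm_add_le x ((‖z‖ / 2) • e)
    rw [norm_smul, hen, Real.norm_eq_abs, abs_of_pos (by positivity)] at this
    linarith
  let R : 𝔼 ≃ₗᵢ[ℝ] 𝔼 := (ℝ ∙ e)ᗮ.reflection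
  have hR : ∀ y, R y = y - (2 * inner ℝ y e) • e := fun y => by
    simp only [R, Submodule.reflection_orthogonal_apply, Submodule.reflection_singleton_apply, hen]
    simp [real_inner_comm, two_smul, two_mul, add_smul]
  have hRl : ∀ y, (R y) last = y last := fun y => by simp [hR, hel]
  have hσ : ∀ y, R (y - p) + p = R y + (p - R p) := fun y => by rw [map_sub]; abel
  have hσl : ∀ y, (R (y - p) + p) last = y last := fun y => by simp [hRl]
  have hσn : ∀ y, ‖y - p‖ ≤ δ → ‖R (y - p) + p‖ < r := fun y hy => by
    have := norm_add_le (R (y - p)) p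
    rw [R.norm_map] at this
    linarith
  have hball : ∀ y : 𝔼, ‖y - p‖ ≤ δ → ‖y‖ < r := fun y hy => by
    linarith [norm_le_norm_add_norm_sub' y p]
  have key := le_barrier (w := fun y => v y - v (R (y - p) + p)) (p := p) (e := e) hδ
    (M := 2 * M) (by positivity) hen
    (by
      refine ContinuousOn.sub
        (h.cont.mono fun y hy => mem_halfBall_union_flatT.2 ⟨hball y hy.1, hy.2.2⟩) ?_
      refine h.cont.comp (by fun_prop) fun y hy => mem_halfBall_union_flatT.2 ⟨hσn y hy.1, ?_⟩
      rw [hσl]; exact hy.2.2)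
    (fun y hy _ hl => by
      refine (h.harm y ⟨hball y hy.le, hl⟩).sub ?_
      simp only [hσ]
      refine HarmonicAt.comp_isometry_add R (p - R p) (h.harm _ ?_)
      rw [← hσ]
      exact ⟨hσn y hy.le, by rw [hσl]; exact hl⟩)
    (fun y hy hl => by
      have h1 := abs_le.1 (h.bound' hM.le (hball y hy) hl)
      have h2 := abs_le.1 (h.bound' hM.le (hσn y hy) (by rw [hσl]; exact hl))
      linarith)
    (fun y hy hl h0 => by
      have : R (y - p) = y - p := by rw [hR, h0]; simp
      simp [this])
    (fun y hy hl => by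
      rw [h.zero' (hball y hy) hl, h.zero' (hσn y hy) (by rw [hσl, hl])]; simp)
    (x := p + (‖z‖ / 2) • e)
    (by rw [add_sub_cancel_left, norm_smul, hen, Real.norm_eq_abs, abs_of_pos (by positivity)]
        linarith)
    (by rw [add_sub_cancel_left, inner_smul_left, real_inner_self_eq_norm_sq, hen]
        simp only [conj_trivial, one_pow, mul_one]
        positivity)
    (by simp [hpl, hel, hl])
  have h1 : p + (‖z‖ / 2) • e = x + z := by
    rw [hp, add_assoc, ← add_smul, add_halves, ← hze]
  have h2 : R (x + z - p) + p = x := by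
    have h3 : x + z - p = (‖z‖ / 2) • e := by rw [← h1, add_sub_cancel_left]
    have h4 : inner ℝ ((‖z‖ / 2) • e) e = ‖z‖ / 2 := by
      rw [inner_smul_left, real_inner_self_eq_norm_sq, hen]; simp
    rw [hR, h3, h4, hp]
    module
  have h5 := barrier_add_smul_le (p := p) (δ := δ) (s := ‖z‖ / 2) hen
  rw [h1] at key h5
  simp only [h2] at key
  calc _ ≤ 2 * M / δ ^ 2 * barrier p e ((n + 3) * δ) (x + z) := key
    _ ≤ 2 * M / δ ^ 2 * ((n + 3) * δ * (‖z‖ / 2)) := by gcongr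
    _ = _ := by field_simp

lemma translate_sub (h : HarmonicDirichlet r M v) (hM : 0 < M) {δ : ℝ} (hδ : 0 < δ)
    {z : 𝔼} (hz : z last = 0) (hz0 : z ≠ 0) (hzδ : ‖z‖ ≤ δ) :
    HarmonicDirichlet (r - 2 * δ) (M * ((n + 3) / δ) * ‖z‖) fun x => v (x + z) - v x := by
  have hn : ∀ x : 𝔼, ‖x‖ < r - 2 * δ → ‖x + z‖ < r := fun x hx => by
    linarith [norm_add_le x z]
  have hl : ∀ x : 𝔼, (x + z) last = x last := fun x => by simp [hz]
  refine ⟨?_, fun x hx => ?_, fun x hx => ?_, fun x hx => ?_⟩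
  · refine ContinuousOn.sub (h.cont.comp (by fun_prop) fun x hx => ?_)
      (h.cont.mono fun x hx => ?_)
    · rw [mem_halfBall_union_flatT] at hx ⊢
      exact ⟨hn x hx.1, by rw [hl]; exact hx.2⟩
    · rw [mem_halfBall_union_flatT] at hx ⊢
      exact ⟨by linarith, hx.2⟩
  · refine HarmonicAt.sub ?_ (h.harm x ⟨by linarith [hx.1], hx.2⟩)
    exact HarmonicAt.comp_isometry_add (LinearIsometryEquiv.refl ℝ _) z
      (h.harm _ ⟨hn x hx.1, by simpa [hl x] using hx.2⟩)
  · rw [h.zero' (hn x hx.1) (by rw [hl, hx.2]), h.zero' (by linarith [hx.1]) hx.2, sub_self]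
  · have h1 := h.neg.sub_le_tangential hM hδ hz hz0 hzδ hx.1 hx.2.le
    simp only [Pi.neg_apply] at h1
    exact abs_le.2 ⟨by linarith, h.sub_le_tangential hM hδ hz hz0 hzδ hx.1 hx.2.le⟩

lemma abs_translate_sub_le (h : HarmonicDirichlet r M v) (hM : 0 < M) {δ : ℝ} (hδ : 0 < δ)
    {z : 𝔼} (hz : z last = 0) (hzδ : ‖z‖ ≤ δ) {x : 𝔼} (hx : ‖x‖ < r - 3 * δ) (hl : 0 < x last) :
    |v (x + z) - v x| ≤ M * ((n + 3) / δ) ^ 2 * x last * ‖z‖ := by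
  rcases eq_or_ne z 0 with rfl | hz0
  · simp
  · have hzn : 0 < ‖z‖ := norm_pos_iff.2 hz0
    refine ((h.translate_sub hM hδ hz hz0 hzδ).abs_le_normal (by positivity) hδ
      (by linarith) hl).trans (le_of_eq (by ring))

lemma abs_mixed_sub_le (h : HarmonicDirichlet r M v) (hM : 0 < M) {δ : ℝ} (hδ : 0 < δ)
    {y z : 𝔼} (hy : y last = 0) (hyδ : ‖y‖ ≤ δ) (hz : z last = 0) (hzδ : ‖z‖ ≤ δ)
    {x : 𝔼} (hx : ‖x‖ < r - 5 * δ) (hl : 0 < x last) :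
    |(v (x + z + y) - v (x + z)) - (v (x + y) - v x)|
      ≤ M * ((n + 3) / δ) ^ 3 * x last * ‖y‖ * ‖z‖ := by
  rcases eq_or_ne y 0 with rfl | hy0
  · simp
  · have hyn : 0 < ‖y‖ := norm_pos_iff.2 hy0
    refine ((h.translate_sub hM hδ hy hy0 hyδ).abs_translate_sub_le (by positivity) hδ hz hzδ
      (by linarith) hl).trans (le_of_eq (by ring))

lemma hasDerivAt_line (h : HarmonicDirichlet r M v) {x : 𝔼} (hx : ‖x‖ < r) (hl : 0 < x last)
    (z : 𝔼) : HasDerivAt (fun s : ℝ => v (x + s • z)) (fderiv ℝ v x z) 0 := by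
  have h1 := (h.harm x ⟨hx, hl⟩).1.differentiableAt (by simp)
  simpa using hasDerivAt_comp_line (f := v) (x := x) (e := z) (s := 0) (by simpa using h1)

lemma eventually_norm_smul_le {δ : ℝ} (hδ : 0 < δ) (z : 𝔼) : ∀ᶠ s : ℝ in 𝓝 0, ‖s • z‖ ≤ δ := by
  have hc : ContinuousAt (fun s : ℝ => ‖s • z‖) 0 := by fun_prop
  exact hc.eventually_le_const (by simpa using hδ)

lemma abs_fderiv_le (h : HarmonicDirichlet r M v) (hM : 0 < M) {δ : ℝ} (hδ : 0 < δ)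
    {z : 𝔼} (hz : z last = 0) {x : 𝔼} (hx : ‖x‖ < r - 3 * δ) (hl : 0 < x last) :
    |fderiv ℝ v x z| ≤ M * ((n + 3) / δ) ^ 2 * x last * ‖z‖ := by
  refine (h.hasDerivAt_line (by linarith) hl z).le_of_lip' (by positivity) ?_
  filter_upwards [eventually_norm_smul_le hδ z] with s hs
  have := h.abs_translate_sub_le hM hδ (z := s • z) (by simp [hz]) hs hx hl
  rw [norm_smul] at this
  simp only [zero_smul, add_zero, sub_zero, Real.norm_eq_abs] at this ⊢
  linarith

lemma abs_fderiv_sub_le (h : HarmonicDirichlet r M v) (hM : 0 < M) {δ : ℝ} (hδ : 0 < δ)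
    {y z : 𝔼} (hy : y last = 0) (hz : z last = 0) (hzδ : ‖z‖ ≤ δ)
    {x : 𝔼} (hx : ‖x‖ < r - 5 * δ) (hl : 0 < x last) :
    |fderiv ℝ v (x + z) y - fderiv ℝ v x y| ≤ M * ((n + 3) / δ) ^ 3 * x last * ‖y‖ * ‖z‖ := by
  have hxz : ‖x + z‖ < r := by linarith [norm_add_le x z]
  refine ((h.hasDerivAt_line hxz (by simpa [hz] using hl) y).sub
    (h.hasDerivAt_line (by linarith) hl y)).le_of_lip' (by positivity) ?_
  filter_upwards [eventually_norm_smul_le hδ y] with s hs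
  have := h.abs_mixed_sub_le hM hδ (y := s • y) (by simp [hy]) hs hz hzδ hx hl
  rw [norm_smul] at this
  simp only [Pi.sub_apply, zero_smul, add_zero, sub_zero, Real.norm_eq_abs] at this ⊢
  rw [show v (x + z + s • y) - v (x + s • y) - (v (x + z) - v x)
    = v (x + z + s • y) - v (x + z) - (v (x + s • y) - v x) by ring]
  linarith

lemma abs_iteratedFDeriv_le (h : HarmonicDirichlet r M v) (hM : 0 < M) {δ : ℝ} (hδ : 0 < δ)
    {z : 𝔼} (hz : z last = 0) {x : 𝔼} (hx : ‖x‖ < r - 5 * δ) (hl : 0 < x last) :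
    |iteratedFDeriv ℝ 2 v x ![z, z]| ≤ M * ((n + 3) / δ) ^ 3 * x last * ‖z‖ ^ 2 := by
  refine (hasDerivAt_deriv_comp_line (h.harm x ⟨by linarith, hl⟩).1 z).le_of_lip'
    (by positivity) ?_
  filter_upwards [eventually_norm_smul_le hδ z] with s hs
  have h1 : deriv (fun s : ℝ => v (x + s • z)) s = fderiv ℝ v (x + s • z) z := by
    refine (hasDerivAt_comp_line ?_).deriv
    refine (h.harm _ ⟨?_, by simpa [hz] using hl⟩).1.differentiableAt (by simp)
    linarith [norm_add_le x (s • z)]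
  rw [h1, (h.hasDerivAt_line (by linarith) hl z).deriv]
  have := h.abs_fderiv_sub_le hM hδ hz (z := s • z) (by simp [hz]) hs hx hl
  rw [norm_smul] at this
  simp only [sub_zero, Real.norm_eq_abs] at this ⊢
  linarith

lemma abs_taylor_le (h : HarmonicDirichlet r M v) (hM : 0 < M) {δ : ℝ} (hδ : 0 < δ)
    {z : 𝔼} (hz : z last = 0) (hzδ : ‖z‖ ≤ δ)
    {x : 𝔼} (hx : ‖x‖ < r - 5 * δ) (hl : 0 < x last) :
    |v (x + z) - v x - fderiv ℝ v x z| ≤ M * ((n + 3) / δ) ^ 3 * x last * ‖z‖ ^ 2 := by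
  have hsz : ∀ s ∈ Set.Icc (0 : ℝ) 1, ‖s • z‖ ≤ ‖z‖ := fun s hs => by
    rw [norm_smul, Real.norm_eq_abs, abs_of_nonneg hs.1]
    exact mul_le_of_le_one_left (norm_nonneg _) hs.2
  have hd : ∀ s ∈ Set.Icc (0 : ℝ) 1,
      HasDerivAt (fun s : ℝ => v (x + s • z)) (fderiv ℝ v (x + s • z) z) s := fun s hs => by
    refine hasDerivAt_comp_line ?_
    refine (h.harm _ ⟨?_, by simpa [hz] using hl⟩).1.differentiableAt (by simp)
    linarith [norm_add_le x (s • z), hsz s hs]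
  obtain ⟨s, hs, hs'⟩ := exists_hasDerivAt_eq_slope (fun s : ℝ => v (x + s • z)) _ one_pos
    (fun s hs => (hd s hs).continuousAt.continuousWithinAt)
    (fun s hs => hd s (Set.Ioo_subset_Icc_self hs))
  have hs1 := Set.Ioo_subset_Icc_self hs
  simp only [one_smul, zero_smul, add_zero, sub_zero, div_one] at hs'
  rw [← hs']
  refine (h.abs_fderiv_sub_le hM hδ hz (z := s • z) (by simp [hz])
    ((hsz s hs1).trans hzδ) hx hl).trans ?_
  rw [pow_two, ← mul_assoc]
  gcongr
  exact hsz s hs1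

lemma abs_iteratedFDeriv_en_le (h : HarmonicDirichlet r M v) (hM : 0 < M) {δ : ℝ} (hδ : 0 < δ)
    {x : 𝔼} (hx : ‖x‖ < r - 5 * δ) (hl : 0 < x last) :
    |iteratedFDeriv ℝ 2 v x ![en n, en n]| ≤ (n + 1) * (M * ((n + 3) / δ) ^ 3) * x last := by
  have h1 := (h.harm x ⟨by linarith, hl⟩).2.self_of_nhds
  rw [laplacian_eq_iteratedFDeriv_orthonormalBasis _ (EuclideanSpace.basisFun (Fin (n + 2)) ℝ)]
    at h1
  simp only [EuclideanSpace.basisFun_apply, Pi.zero_apply] at h1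
  rw [Fin.sum_univ_castSucc] at h1
  rw [en, eq_neg_of_add_eq_zero_right h1, abs_neg]
  refine (Finset.abs_sum_le_sum_abs _ _).trans ?_
  refine (Finset.sum_le_sum fun i _ => h.abs_iteratedFDeriv_le hM hδ ?_ hx hl).trans
    (le_of_eq ?_)
  · simp [(Fin.castSucc_lt_last i).ne']
  · simp
    ring

end HarmonicDirichlet

lemma div_le_div_add_of_deriv2_ge {f f' f'' : ℝ → ℝ} {H s t : ℝ} (hs : 0 < s) (hst : s ≤ t)
    (hc : ContinuousOn f (Set.Icc 0 t)) (h0 : f 0 = 0)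
    (hf : ∀ τ ∈ Set.Ioo 0 t, HasDerivAt f (f' τ) τ)
    (hf' : ∀ τ ∈ Set.Ioo 0 t, HasDerivAt f' (f'' τ) τ)
    (hH : ∀ τ ∈ Set.Ioo 0 t, -(H * τ) ≤ f'' τ) (hH0 : 0 ≤ H) :
    f s / s ≤ f t / t + H * t ^ 2 := by
  have ht : 0 < t := hs.trans_le hst
  have hconv : ConvexOn ℝ (Set.Icc 0 t) fun τ => f τ + H / 6 * τ ^ 3 := by
    refine convexOn_of_hasDerivWithinAt2_nonneg (f' := fun τ => f' τ + H / 2 * τ ^ 2)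
      (f'' := fun τ => f'' τ + H * τ) (convex_Icc 0 t) (by fun_prop) ?_ ?_ ?_ <;>
      rw [interior_Icc] <;> intro τ hτ
    · refine HasDerivAt.hasDerivWithinAt (((hf τ hτ).add
        (((hasDerivAt_id' τ).fun_pow 3).const_mul (H / 6))).congr_deriv ?_)
      norm_num; ring
    · refine HasDerivAt.hasDerivWithinAt (((hf' τ hτ).add
        (((hasDerivAt_id' τ).fun_pow 2).const_mul (H / 2))).congr_deriv ?_)
      norm_num; ring
    · linarith [hH τ hτ]
  have := hconv.secant_mono (a := 0) (x := s) (y := t) ⟨le_rfl, ht.le⟩ ⟨hs.le, hst⟩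
    ⟨ht.le, le_rfl⟩ hs.ne' ht.ne' hst
  simp only [h0, sub_zero] at this
  have e1 : (f s + H / 6 * s ^ 3 - (0 + H / 6 * 0 ^ 3)) / s = f s / s + H / 6 * s ^ 2 := by
    field_simp; ring
  have e2 : (f t + H / 6 * t ^ 3 - (0 + H / 6 * 0 ^ 3)) / t = f t / t + H / 6 * t ^ 2 := by
    field_simp; ring
  rw [e1, e2] at this
  nlinarith [mul_nonneg hH0 (sq_nonneg s), mul_nonneg hH0 (sq_nonneg t)]

namespace HarmonicDirichlet

variable {r M : ℝ} {v : EuclideanSpace ℝ (Fin (n + 2)) → ℝ}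

lemma div_sub_div_le (h : HarmonicDirichlet r M v) (hM : 0 < M) {δ : ℝ} (hδ : 0 < δ)
    {p : 𝔼} (hp : p last = 0) {s t : ℝ} (hs : 0 < s) (hst : s ≤ t) (hpt : ‖p‖ + t < r - 5 * δ) :
    v (p + s • en n) / s
      ≤ v (p + t • en n) / t + (n + 1) * (M * ((n + 3) / δ) ^ 3) * t ^ 2 := by
  have ht : 0 < t := hs.trans_le hst
  have hl : ∀ τ : ℝ, (p + τ • en n) last = τ := fun τ => by simp [hp, en_last]
  have hn : ∀ τ ∈ Set.Icc 0 t, ‖p + τ • en n‖ < r - 5 * δ := fun τ hτ => by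
    have := norm_add_le p (τ • en n)
    rw [norm_smul, norm_en, Real.norm_eq_abs, abs_of_nonneg hτ.1] at this
    linarith [hτ.2]
  have hharm : ∀ τ ∈ Set.Ioo 0 t, HarmonicAt v (p + τ • en n) := fun τ hτ =>
    h.harm _ ⟨by linarith [hn τ (Set.Ioo_subset_Icc_self hτ)], by simpa only [hl τ] using hτ.1⟩
  refine div_le_div_add_of_deriv2_ge (f := fun τ => v (p + τ • en n)) hs hst ?_ ?_
    (fun τ hτ => (hasDerivAt_comp_line ((hharm τ hτ).1.differentiableAt (by simp))))
    (f'' := fun τ => iteratedFDeriv ℝ 2 v (p + τ • en n) ![en n, en n]) ?_ ?_ (by positivity)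
  · refine h.cont.comp (by fun_prop) fun τ hτ => mem_halfBall_union_flatT.2 ⟨?_, ?_⟩
    · linarith [hn τ hτ]
    · rw [hl]; exact hτ.1
  · exact h.zero' (by linarith [hn 0 ⟨le_rfl, ht.le⟩]) (hl 0)
  · intro τ hτ
    have h1 := hasDerivAt_deriv_comp_line (hharm τ hτ).1 (en n)
    have h2 := HasDerivAt.comp_sub_const (x := τ) (a := τ)
      (f := deriv fun s : ℝ => v (p + τ • en n + s • en n)) (by simpa using h1)
    refine h2.congr_of_eventuallyEq ?_
    filter_upwards [Ioo_mem_nhds hτ.1 hτ.2] with σ hσ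
    have e : p + τ • en n + (σ - τ) • en n = p + σ • en n := by module
    rw [(hasDerivAt_comp_line (by rw [e]; exact (hharm σ hσ).1.differentiableAt (by simp))).deriv,
      e]
  · intro τ hτ
    have := h.abs_iteratedFDeriv_en_le hM hδ (hn τ (Set.Ioo_subset_Icc_self hτ))
      (by simpa only [hl τ] using hτ.1)
    rw [hl] at this
    exact (abs_le.1 this).1

lemma abs_div_sub_div_le (h : HarmonicDirichlet r M v) (hM : 0 < M) {δ : ℝ} (hδ : 0 < δ)
    {p : 𝔼} (hp : p last = 0) {s t : ℝ} (hs : 0 < s) (hst : s ≤ t) (hpt : ‖p‖ + t < r - 5 * δ) :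
    |v (p + t • en n) / t - v (p + s • en n) / s|
      ≤ (n + 1) * (M * ((n + 3) / δ) ^ 3) * t ^ 2 := by
  have h1 := h.div_sub_div_le hM hδ hp hs hst hpt
  have h2 := h.neg.div_sub_div_le hM hδ hp hs hst hpt
  simp only [Pi.neg_apply, neg_div] at h2
  exact abs_le.2 ⟨by linarith, by linarith⟩

/-- The slopes at height `τ` above the origin that enter the second order expansion of `v`. -/
def tangentialSlope (v : 𝔼 → ℝ) (τ : ℝ) (i : Fin (n + 2)) : ℝ :=
  if i = last then 0 else fderiv ℝ v (τ • en n) (EuclideanSpace.single i 1) / τ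

lemma sum_tangentialSlope (v : 𝔼 → ℝ) (τ : ℝ) (x : 𝔼) :
    ∑ i, tangentialSlope v τ i * x i = fderiv ℝ v (τ • en n) (x - x last • en n) / τ := by
  set p : 𝔼 := x - x last • en n with hp
  have hp1 : p = ∑ i, p i • EuclideanSpace.single i (1 : ℝ) := by
    simpa using ((EuclideanSpace.basisFun (Fin (n + 2)) ℝ).sum_repr p).symm
  conv_rhs => rw [hp1]
  rw [map_sum, Finset.sum_div]
  refine Finset.sum_congr rfl fun i _ => ?_
  rw [tangentialSlope]
  split_ifs with hi
  · simp [hi, hp, en_last]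
  · simp [hp, en, hi]
    ring

lemma abs_div_sub_expansion_le (h : HarmonicDirichlet r M v) (hM : 0 < M) {δ : ℝ} (hδ : 0 < δ)
    {x : 𝔼} (hxδ : ‖x‖ ≤ δ) (hx : 2 * ‖x‖ < r - 5 * δ) {τ : ℝ} (hτ : 0 < τ) (hτx : τ ≤ x last) :
    |v x / x last - (v (τ • en n) / τ + ∑ i, tangentialSlope v τ i * x i)|
      ≤ (n + 2) * (M * ((n + 3) / δ) ^ 3) * ‖x‖ ^ 2 := by
  set p : 𝔼 := x - x last • en n with hp
  have hpl : p last = 0 := by simp [hp, en_last]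
  have hpx : p + x last • en n = x := by simp [hp]
  have hl : 0 < x last := hτ.trans_le hτx
  have hsq : ‖x‖ ^ 2 = ‖p‖ ^ 2 + x last ^ 2 := by
    rw [← hpx, norm_add_sq_real, hpx, inner_smul_right, inner_en, hpl, norm_smul, norm_en,
      mul_one, Real.norm_eq_abs, sq_abs]
    ring
  have hpn : ‖p‖ ≤ ‖x‖ := abs_le_of_sq_le_sq' (by nlinarith) (norm_nonneg _) |>.2
  have hln : x last ≤ ‖x‖ := abs_le_of_sq_le_sq' (by nlinarith) (norm_nonneg _) |>.2
  have h1 := h.abs_div_sub_div_le hM hδ hpl hτ hτx (by linarith)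
  rw [hpx] at h1
  have hτl : (τ • en n) last = τ := by simp [en_last]
  have h2 := h.abs_taylor_le hM hδ hpl (hpn.trans hxδ) (x := τ • en n)
    (by rw [norm_smul, norm_en, Real.norm_eq_abs, abs_of_pos hτ]; linarith [norm_nonneg x])
    (by rw [hτl]; exact hτ)
  rw [hτl, add_comm] at h2
  have h3 : |v (p + τ • en n) / τ - (v (τ • en n) / τ + fderiv ℝ v (τ • en n) p / τ)|
      ≤ M * ((n + 3) / δ) ^ 3 * ‖p‖ ^ 2 := by
    rw [← add_div, ← sub_div, abs_div, abs_of_pos hτ, div_le_iff₀ hτ, ← sub_sub]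
    linarith
  rw [sum_tangentialSlope]
  calc _ ≤ (n + 1) * (M * ((n + 3) / δ) ^ 3) * x last ^ 2
        + M * ((n + 3) / δ) ^ 3 * ‖p‖ ^ 2 := (abs_sub_le _ _ _).trans (add_le_add h1 h3)
    _ ≤ (n + 1) * (M * ((n + 3) / δ) ^ 3) * ‖x‖ ^ 2
        + M * ((n + 3) / δ) ^ 3 * ‖x‖ ^ 2 := by gcongr
    _ = _ := by ring

lemma exists_expansion (h : HarmonicDirichlet r M v) (hM : 0 < M) {δ : ℝ} (hδ : 0 < δ)
    (hr : 7 * δ ≤ r) :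
    ∃ (a : Fin (n + 2) → ℝ) (b : ℝ), a last = 0 ∧ |b| ≤ M * ((n + 3) / δ)
      ∧ (∀ i, |a i| ≤ M * ((n + 3) / δ) ^ 2) ∧ ∀ x ∈ halfBall n δ,
        |v x - ((∑ i, a i * x i * x last) + b * x last)|
          ≤ (n + 2) * (M * ((n + 3) / δ) ^ 3) * ‖x‖ ^ 3 := by
  set τ : ℕ → ℝ := fun k => δ / (k + 1) with hτdef
  have hτ : ∀ k, 0 < τ k := fun k => by positivity
  have hτδ : ∀ k, τ k ≤ δ := fun k =>
    div_le_self hδ.le (by linarith [Nat.cast_nonneg (α := ℝ) k])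
  have hτl : ∀ k, (τ k • en n) last = τ k := fun k => by simp [en_last]
  have hτn : ∀ k, ‖τ k • en n‖ ≤ δ := fun k => by
    rw [norm_smul, norm_en, Real.norm_eq_abs, abs_of_pos (hτ k), mul_one]; exact hτδ k
  have hlim : Tendsto τ atTop (𝓝 0) := by
    have := (tendsto_one_div_add_atTop_nhds_zero_nat (𝕜 := ℝ)).const_mul δ
    simpa [hτdef, div_eq_mul_inv] using this
  set K : Set ((Fin (n + 2) → ℝ) × ℝ) :=
    (Set.univ.pi fun _ => Set.Icc (-(M * ((n + 3) / δ) ^ 2)) (M * ((n + 3) / δ) ^ 2)) ×ˢ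
      Set.Icc (-(M * ((n + 3) / δ))) (M * ((n + 3) / δ)) with hK
  have hKc : IsCompact K := (isCompact_univ_pi fun _ => isCompact_Icc).prod isCompact_Icc
  have hmem : ∀ k, (tangentialSlope v (τ k), v (τ k • en n) / τ k) ∈ K := fun k => by
    refine ⟨fun i _ => abs_le.1 ?_, abs_le.1 ?_⟩
    · simp only [tangentialSlope]
      split_ifs with hi
      · rw [abs_zero]; positivity
      · rw [abs_div, abs_of_pos (hτ k), div_le_iff₀ (hτ k)]
        have := h.abs_fderiv_le hM hδ (z := EuclideanSpace.single i 1) (x := τ k • en n)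
          (by simp [Ne.symm hi]) (by linarith [hτn k]) (by rw [hτl]; exact hτ k)
        rw [hτl] at this
        simpa using this
    · rw [abs_div, abs_of_pos (hτ k), div_le_iff₀ (hτ k)]
      have := h.abs_le_normal hM hδ (x := τ k • en n) (by linarith [hτn k])
        (by rw [hτl]; exact hτ k)
      rwa [hτl] at this
  obtain ⟨⟨a, b⟩, hab, φ, hφ, hφlim⟩ := hKc.tendsto_subseq hmem
  have hb : Tendsto (fun k => v (τ (φ k) • en n) / τ (φ k)) atTop (𝓝 b) :=
    (continuous_snd.tendsto _).comp hφlim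
  have ha : ∀ i, Tendsto (fun k => tangentialSlope v (τ (φ k)) i) atTop (𝓝 (a i)) := fun i =>
    (((continuous_apply i).comp continuous_fst).tendsto (a, b)).comp hφlim
  refine ⟨a, b, ?_, abs_le.2 hab.2, fun i => abs_le.2 (hab.1 i trivial), fun x hx => ?_⟩
  · refine tendsto_nhds_unique (ha last) ?_
    simp [tangentialSlope]
  · obtain ⟨hxn, hxl⟩ := hx
    have h1 : |v x / x last - (b + ∑ i, a i * x i)|
        ≤ (n + 2) * (M * ((n + 3) / δ) ^ 3) * ‖x‖ ^ 2 := by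
      refine le_of_tendsto (((hb.add (tendsto_finsetSum _ fun i _ =>
        (ha i).mul_const (x i))).const_sub (v x / x last)).abs) ?_
      filter_upwards [hφ.tendsto_atTop.eventually (hlim.eventually_le_const hxl)] with k hk
      exact h.abs_div_sub_expansion_le hM hδ hxn.le (by linarith) (hτ _) hk
    have hln : x last ≤ ‖x‖ := (le_abs_self _).trans (PiLp.norm_apply_le x last)
    have h2 : v x - ((∑ i, a i * x i * x last) + b * x last)
        = (v x / x last - (b + ∑ i, a i * x i)) * x last := by
      rw [← Finset.sum_mul]
      field_simp
      ring
    rw [h2, abs_mul, abs_of_pos hxl, pow_succ ‖x‖ 2, ← mul_assoc]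
    gcongr

end HarmonicDirichlet

lemma lapl_eq_laplacian {m : ℕ} {u : EuclideanSpace ℝ (Fin m) → ℝ} {x : EuclideanSpace ℝ (Fin m)}
    (hu : ContDiffAt ℝ 2 u x) : lapl u x = Δ u x := by
  rw [laplacian_eq_iteratedFDeriv_orthonormalBasis _ (EuclideanSpace.basisFun (Fin m) ℝ), lapl]
  refine Finset.sum_congr rfl fun i _ => ?_
  have h1 : DifferentiableAt ℝ (fderiv ℝ u) x :=
    (hu.fderiv_right (m := 1) (by norm_num)).differentiableAt (by simp)
  rw [iteratedFDeriv_two_apply, fderiv_clm_apply h1 (differentiableAt_const _)]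
  simp

lemma contDiff_half_sq_last : ContDiff ℝ 2 fun y : 𝔼 => y last ^ 2 / 2 := by
  have h : ContDiff ℝ 2 fun y : 𝔼 => inner ℝ y (en n) := contDiff_id.inner ℝ contDiff_const
  simp only [inner_en] at h
  exact (h.pow 2).div_const 2

lemma laplacian_half_sq_last (x : 𝔼) : Δ (fun y : 𝔼 => y last ^ 2 / 2 : 𝔼 → ℝ) x = 1 := by
  rw [laplacian_eq_iteratedFDeriv_orthonormalBasis _ (EuclideanSpace.basisFun (Fin (n + 2)) ℝ)]
  have key : ∀ i : Fin (n + 2), iteratedFDeriv ℝ 2 (fun y : 𝔼 => y last ^ 2 / 2) x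
      ![EuclideanSpace.basisFun (Fin (n + 2)) ℝ i, EuclideanSpace.basisFun (Fin (n + 2)) ℝ i]
      = if i = last then 1 else 0 := by
    intro i
    rw [iteratedFDeriv_two_of_quadratic contDiff_half_sq_last.contDiffAt
      (a := x last ^ 2 / 2) (b := if i = last then x last else 0)
      (q := if i = last then 1 / 2 else 0)]
    · split_ifs <;> norm_num
    · intro s
      by_cases hi : i = last
      · subst hi
        simp
        ring
      · simp [hi, Ne.symm hi]
  simp only [key]
  simp

lemma harmonicDirichlet_sub_half_sq {u : 𝔼 → ℝ} {M : ℝ}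
    (hc : ContinuousOn u (halfBall n 1 ∪ flatT n 1)) (hu : ContDiffOn ℝ 2 u (halfBall n 1))
    (hl : ∀ x ∈ halfBall n 1, lapl u x = 1) (h0 : ∀ x ∈ flatT n 1, u x = 0)
    (hb : ∀ x ∈ halfBall n 1, |u x| ≤ M) :
    HarmonicDirichlet 1 (M + 1) fun x => u x - x last ^ 2 / 2 where
  cont := hc.sub (contDiff_half_sq_last.continuous.continuousOn)
  harm x hx := by
    have hat : ∀ y ∈ halfBall n 1, ContDiffAt ℝ 2 u y := fun y hy =>
      hu.contDiffAt ((isOpen_halfBall 1).mem_nhds hy)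
    refine ⟨(hat x hx).sub contDiff_half_sq_last.contDiffAt, ?_⟩
    filter_upwards [(isOpen_halfBall 1).mem_nhds hx] with y hy
    refine ((hat y hy).laplacian_sub contDiff_half_sq_last.contDiffAt).trans ?_
    rw [← lapl_eq_laplacian (hat y hy), hl y hy, laplacian_half_sq_last]
    simp
  zero x hx := by simp [h0 x hx, hx.2]
  bound x hx := by
    have h1 : x last ≤ 1 := (le_abs_self _).trans ((PiLp.norm_apply_le x last).trans hx.1.le)
    have h2 : x last ^ 2 ≤ 1 := pow_le_one₀ hx.2.le h1
    have h3 := abs_le.1 (hb x hx)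
    exact abs_le.2 ⟨by linarith, by nlinarith [sq_nonneg (x last)]⟩

lemma HarmonicDirichlet.exists_global_expansion {M : ℝ} {v : 𝔼 → ℝ}
    (h : HarmonicDirichlet 1 M v) (hM : 0 < M) :
    ∃ (a : Fin (n + 2) → ℝ) (b : ℝ), a last = 0 ∧ ∀ x ∈ halfBall n 1,
        |v x - ((∑ i, a i * x i * x last) + b * x last)|
          ≤ 512 * (1 + (n + 3) / (1 / 8) + (n + 2) * ((n + 3) / (1 / 8)) ^ 2
            + (n + 2) * ((n + 3) / (1 / 8)) ^ 3) * M * ‖x‖ ^ 3 := by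
  obtain ⟨a, b, ha, hbκ, haκ, hab⟩ := h.exists_expansion hM (δ := 1 / 8) (by norm_num) (by norm_num)
  set κ : ℝ := (n + 3) / (1 / 8) with hκ
  have hκ0 : 0 < κ := by positivity
  refine ⟨a, b, ha, fun x hx => ?_⟩
  rcases lt_or_ge ‖x‖ (1 / 8) with hx8 | hx8
  · refine (hab x ⟨hx8, hx.2⟩).trans ?_
    refine mul_le_mul_of_nonneg_right ?_ (by positivity)
    have h1 : 0 < M * (1 + κ + (n + 2) * κ ^ 2) := by positivity
    have h2 : 0 < M * ((n + 2) * κ ^ 3) := by positivity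
    linarith
  · have hxi : ∀ i, |x i| ≤ 1 := fun i => (PiLp.norm_apply_le x i).trans hx.1.le
    have hsum : |∑ i, a i * x i * x last| ≤ (n + 2) * (M * κ ^ 2) := by
      refine (Finset.abs_sum_le_sum_abs _ _).trans ?_
      refine (Finset.sum_le_sum (g := fun _ => M * κ ^ 2) fun i _ => ?_).trans
        (le_of_eq (by simp))
      rw [abs_mul, abs_mul]
      calc _ ≤ M * κ ^ 2 * 1 * 1 := by
            gcongr
            exacts [haκ i, hxi i, hxi last]
        _ = _ := by ring
    have hbx : |b * x last| ≤ M * κ := by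
      rw [abs_mul]
      calc _ ≤ M * κ * 1 := by
            gcongr
            exact hxi last
        _ = _ := by ring
    have h8 : 1 ≤ 512 * ‖x‖ ^ 3 := by
      have := pow_le_pow_left₀ (by norm_num) hx8 3
      linarith
    have hpos : 0 < M * ((n + 2) * κ ^ 3) := by positivity
    calc _ ≤ |v x| + (|∑ i, a i * x i * x last| + |b * x last|) :=
          (abs_sub _ _).trans (add_le_add le_rfl (abs_add_le _ _))
      _ ≤ (1 + κ + (n + 2) * κ ^ 2 + (n + 2) * κ ^ 3) * M * 1 := by
          linarith [h.bound x hx]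
      _ ≤ (1 + κ + (n + 2) * κ ^ 2 + (n + 2) * κ ^ 3) * M * (512 * ‖x‖ ^ 3) := by gcongr
      _ = _ := by ring

end HalfSpace

theorem boundary_pointwise_C2alpha (n : ℕ) :
    ∃ α C : ℝ, 0 < α ∧ α < 1 ∧ 0 < C ∧
      ∀ (u : EuclideanSpace ℝ (Fin (n + 2)) → ℝ) (M : ℝ), 0 ≤ M →
        ContinuousOn u (halfBall n 1 ∪ flatT n 1) →
        ContDiffOn ℝ 2 u (halfBall n 1) →
        (∀ x ∈ halfBall n 1, lapl u x = 1) →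
        (∀ x ∈ flatT n 1, u x = 0) →
        (∀ x ∈ halfBall n 1, |u x| ≤ M) →
        ∃ (a : Fin (n + 2) → ℝ) (b : ℝ), 2 * a (Fin.last (n + 1)) = 1 ∧
          ∀ x ∈ halfBall n (1 / 2),
            |u x - ((∑ i : Fin (n + 2), a i * x i * x (Fin.last (n + 1))) +
              b * x (Fin.last (n + 1)))| ≤ C * ‖x‖ ^ (2 + α) * (M + 1) := by
  refine ⟨1 / 2, 512 * (1 + (n + 3) / (1 / 8) + (n + 2) * ((n + 3) / (1 / 8)) ^ 2
    + (n + 2) * ((n + 3) / (1 / 8)) ^ 3), by norm_num, by norm_num, by positivity, ?_⟩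
  intro u M hM hc hu hl h0 hb
  obtain ⟨a, b, ha, hab⟩ :=
    (harmonicDirichlet_sub_half_sq hc hu hl h0 hb).exists_global_expansion (by linarith)
  refine ⟨fun i => a i + if i = Fin.last (n + 1) then 1 / 2 else 0, b, by simp [ha], ?_⟩
  intro x hx
  have hx1 : ‖x‖ ≤ 1 := by linarith [hx.1]
  have hx0 : 0 < ‖x‖ := norm_pos_iff.2 fun h => by simpa [h] using hx.2
  have hpow : ‖x‖ ^ 3 ≤ ‖x‖ ^ ((2 : ℝ) + 1 / 2) := by
    rw [← Real.rpow_natCast]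
    exact Real.rpow_le_rpow_of_exponent_ge hx0 hx1 (by norm_num)
  have hsum : ∑ i, (a i + if i = Fin.last (n + 1) then 1 / 2 else 0) * x i * x (Fin.last (n + 1))
      = ∑ i, a i * x i * x (Fin.last (n + 1)) + x (Fin.last (n + 1)) ^ 2 / 2 := by
    simp only [add_mul, Finset.sum_add_distrib, ite_mul, zero_mul, Finset.sum_ite_eq',
      Finset.mem_univ, if_true]
    ring
  rw [hsum, mul_right_comm _ _ (M + 1)]
  refine le_trans (le_of_eq ?_) ((hab x ⟨by linarith [hx.1], hx.2⟩).trans ?_)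
  · congr 1
    ring
  · gcongr
end
end

section
/- For every r₀ ∈ (0, 1/2) there exists a constant C > 0 depending only on n and r₀ with the following property (Hopf lemma under an interior sphere condition): let Ω ⊆ ℝⁿ be open with 0 ∈ ∂Ω and with the open ball B(r₀·eₙ, r₀) of center r₀·eₙ and radius r₀ contained in Ω; let u be continuous on (Ω ∩ B₁) ∪ (∂Ω ∩ B₁), harmonic on Ω ∩ B₁, with u ≥ 0 on Ω ∩ B₁, u = 0 on ∂Ω ∩ B₁, and u(r₀·eₙ) = 1. Then u(t·eₙ) ≥ C·t for every t ∈ (0, r₀/2). -/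
noncomputable section

open MeasureTheory Metric Set Filter Topology

theorem hasDerivAt_max_zero_pow_three (s : ℝ) :
    HasDerivAt (fun s : ℝ => max 0 s ^ 3) (3 * max 0 s ^ 2) s := by
  rcases lt_trichotomy s 0 with hs | rfl | hs
  · have h : (fun s : ℝ => max 0 s ^ 3) =ᶠ[𝓝 s] fun _ => 0 := by
      filter_upwards [gt_mem_nhds hs] with a ha
      simp [max_eq_left ha.le]
    simpa [max_eq_left hs.le] using (hasDerivAt_const s (0 : ℝ)).congr_of_eventuallyEq h
  · have h : (fun s : ℝ => max 0 s ^ 3) =O[𝓝 0] fun s : ℝ => ‖s - 0‖ ^ 3 := by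
      refine Asymptotics.IsBigO.of_bound 1 (Eventually.of_forall fun a => ?_)
      rw [sub_zero, one_mul, norm_pow, norm_pow, norm_norm]
      gcongr
      rw [Real.norm_eq_abs, Real.norm_eq_abs, abs_of_nonneg (le_max_left _ _)]
      exact max_le (abs_nonneg a) (le_abs_self a)
    simpa using (h.hasFDerivAt (by norm_num)).hasDerivAt
  · have h : (fun s : ℝ => max 0 s ^ 3) =ᶠ[𝓝 s] fun s => s ^ 3 := by
      filter_upwards [lt_mem_nhds hs] with a ha
      simp [max_eq_right ha.le]
    simpa [max_eq_right hs.le] using (hasDerivAt_pow 3 s).congr_of_eventuallyEq h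

section Normed

variable {E : Type*} [NormedAddCommGroup E]

/-- The radial weight `(1 - |y|²)₊ ^ k`, supported in the closed unit ball. -/
def radialWeight (k : ℕ) (y : E) : ℝ := max 0 (1 - ‖y‖ ^ 2) ^ k

theorem radialWeight_nonneg (k : ℕ) (y : E) : 0 ≤ radialWeight k y :=
  pow_nonneg (le_max_left _ _) k

theorem radialWeight_le_one (k : ℕ) (y : E) : radialWeight k y ≤ 1 :=
  pow_le_one₀ (le_max_left _ _) (max_le zero_le_one (sub_le_self _ (sq_nonneg _)))

theorem radialWeight_eq_zero {k : ℕ} (hk : k ≠ 0) {y : E} (hy : 1 ≤ ‖y‖) :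
    radialWeight k y = 0 := by
  rw [radialWeight, max_eq_left (by nlinarith), zero_pow hk]

theorem continuous_radialWeight (k : ℕ) : Continuous (radialWeight k : E → ℝ) := by
  unfold radialWeight
  fun_prop

theorem hasCompactSupport_radialWeight [ProperSpace E] {k : ℕ} (hk : k ≠ 0) :
    HasCompactSupport (radialWeight k : E → ℝ) :=
  HasCompactSupport.intro (isCompact_closedBall (0 : E) 1) fun y hy =>
    radialWeight_eq_zero hk (by simpa using (not_le.mp (mt mem_closedBall_zero_iff.mpr hy)).le)

end Normed

section InnerProductSpace

variable {E : Type*} [NormedAddCommGroup E] [InnerProductSpace ℝ E]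

theorem hasFDerivAt_radialWeight_three (y : E) :
    HasFDerivAt (radialWeight 3 : E → ℝ)
      ((3 * max 0 (1 - ‖y‖ ^ 2) ^ 2) • (-(2 • innerSL ℝ y) : E →L[ℝ] ℝ)) y := by
  have h : HasFDerivAt (fun z : E => 1 - ‖z‖ ^ 2) (-(2 • innerSL ℝ y)) y :=
    (hasStrictFDerivAt_norm_sq y).hasFDerivAt.const_sub 1
  exact (hasDerivAt_max_zero_pow_three _).comp_hasFDerivAt y h

theorem fderiv_radialWeight_three (y v : E) :
    fderiv ℝ (radialWeight 3) y v = -6 * (inner ℝ y v * radialWeight 2 y) := by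
  rw [(hasFDerivAt_radialWeight_three y).fderiv]
  simp [radialWeight]
  ring

theorem integral_radialWeight_pos [FiniteDimensional ℝ E] [MeasurableSpace E] [BorelSpace E] :
    0 < ∫ y : E, radialWeight 2 y :=
  (continuous_radialWeight 2).integral_pos_of_hasCompactSupport_nonneg_nonzero
    (hasCompactSupport_radialWeight two_ne_zero) (radialWeight_nonneg 2)
    (x := 0) (by simp [radialWeight])

end InnerProductSpace

section Euclidean

variable {m : ℕ}

theorem integral_fderiv_mul_radialWeight {w : EuclideanSpace ℝ (Fin m) → ℝ}
    (hw : ContDiff ℝ 2 w) {x : EuclideanSpace ℝ (Fin m)} {R ρ : ℝ}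
    (hlap : ∀ z ∈ ball x R, lapl w z = 0) (hρ : 0 ≤ ρ) (hρR : ρ < R) :
    ∫ y : EuclideanSpace ℝ (Fin m), fderiv ℝ w (x + ρ • y) y * radialWeight 2 y = 0 := by
  have hd : ∀ v : EuclideanSpace ℝ (Fin m), ContDiff ℝ 1 fun z => fderiv ℝ w z v := fun v =>
    (hw.fderiv_right (m := 1) (by norm_num)).clm_apply contDiff_const
  have hcd : ∀ v : EuclideanSpace ℝ (Fin m),
      Continuous fun z => fderiv ℝ (fun z' => fderiv ℝ w z' v) z v := fun v =>
    ((hd v).continuous_fderiv one_ne_zero).clm_apply continuous_const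
  have haff : Continuous fun y : EuclideanSpace ℝ (Fin m) => x + ρ • y := by fun_prop
  have hint : ∀ {k : ℕ} {f : EuclideanSpace ℝ (Fin m) → ℝ}, k ≠ 0 → Continuous f →
      Integrable fun y => f y * radialWeight k y := fun hk hf =>
    (hf.mul (continuous_radialWeight _)).integrable_of_hasCompactSupport
      (hasCompactSupport_radialWeight hk).mul_left
  have hfd : ∀ v y : EuclideanSpace ℝ (Fin m),
      HasFDerivAt (fun y => fderiv ℝ w (x + ρ • y) v)
        (ρ • fderiv ℝ (fun z => fderiv ℝ w z v) (x + ρ • y)) y := by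
    intro v y
    have h1 : HasFDerivAt (fun y : EuclideanSpace ℝ (Fin m) => x + ρ • y)
        (ρ • ContinuousLinearMap.id ℝ (EuclideanSpace ℝ (Fin m))) y :=
      ((hasFDerivAt_id y).const_smul ρ).const_add x
    refine ((((hd v).differentiable one_ne_zero) (x + ρ • y)).hasFDerivAt.comp y h1).congr_fderiv ?_
    ext z
    simp
  have hparts : ∀ v : EuclideanSpace ℝ (Fin m),
      -6 * ∫ y : EuclideanSpace ℝ (Fin m),
        fderiv ℝ w (x + ρ • y) v * (inner ℝ y v * radialWeight 2 y) =
      -(ρ * ∫ y : EuclideanSpace ℝ (Fin m),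
        fderiv ℝ (fun z => fderiv ℝ w z v) (x + ρ • y) v * radialWeight 3 y) := by
    intro v
    have hc1 : Continuous fun y => fderiv ℝ w (x + ρ • y) v := (hd v).continuous.comp haff
    have hc2 := (hcd v).comp haff
    have := integral_mul_fderiv_eq_neg_fderiv_mul_of_integrable (μ := volume)
      (f := fun y => fderiv ℝ w (x + ρ • y) v) (g := radialWeight 3) (v := v)
      (by
        simp only [(hfd v _).fderiv]
        exact hint three_ne_zero (hc2.const_smul ρ))
      (by
        simp only [fderiv_radialWeight_three]
        refine (hint two_ne_zero
          (f := fun y => fderiv ℝ w (x + ρ • y) v * (-6 * inner ℝ y v)) (by fun_prop)).congr ?_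
        exact Eventually.of_forall fun y => by dsimp only; ring)
      (hint three_ne_zero hc1)
      (fun y _ => (hfd v y).differentiableAt)
      (fun y _ => (hasFDerivAt_radialWeight_three y).differentiableAt)
    simp only [fderiv_radialWeight_three, (hfd v _).fderiv, smul_apply,
      smul_eq_mul, mul_assoc, integral_const_mul] at this
    rw [← integral_const_mul, ← this]
    exact integral_congr_ae (Eventually.of_forall fun y => by dsimp only; ring)
  have hexp : ∀ y : EuclideanSpace ℝ (Fin m), fderiv ℝ w (x + ρ • y) y * radialWeight 2 y =
      ∑ i, fderiv ℝ w (x + ρ • y) (EuclideanSpace.single i 1) *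
        (inner ℝ y (EuclideanSpace.single i (1 : ℝ)) * radialWeight 2 y) := by
    intro y
    have hy : y = ∑ i, y i • EuclideanSpace.single i (1 : ℝ) := by
      simpa using ((EuclideanSpace.basisFun (Fin m) ℝ).sum_repr y).symm
    conv_lhs => rw [show fderiv ℝ w (x + ρ • y) y =
      fderiv ℝ w (x + ρ • y) (∑ i, y i • EuclideanSpace.single i (1 : ℝ)) by rw [← hy]]
    rw [map_sum, Finset.sum_mul]
    refine Finset.sum_congr rfl fun i _ => ?_
    simp [EuclideanSpace.inner_single_right]
    ring
  have hzero : ∀ y : EuclideanSpace ℝ (Fin m),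
      ∑ i, fderiv ℝ (fun z => fderiv ℝ w z (EuclideanSpace.single i 1)) (x + ρ • y)
        (EuclideanSpace.single i 1) * radialWeight 3 y = 0 := by
    intro y
    rw [← Finset.sum_mul]
    rcases le_or_gt 1 ‖y‖ with hy | hy
    · rw [radialWeight_eq_zero three_ne_zero hy, mul_zero]
    · rw [show ∑ i, fderiv ℝ (fun z => fderiv ℝ w z (EuclideanSpace.single i 1)) (x + ρ • y)
        (EuclideanSpace.single i 1) = lapl w (x + ρ • y) from rfl, hlap, zero_mul]
      rw [mem_ball_iff_norm, add_sub_cancel_left, norm_smul, Real.norm_of_nonneg hρ]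
      nlinarith
  simp only [hexp]
  rw [integral_finsetSum]
  · have hsum : -6 * ∑ i, ∫ y : EuclideanSpace ℝ (Fin m),
        fderiv ℝ w (x + ρ • y) (EuclideanSpace.single i 1) *
          (inner ℝ y (EuclideanSpace.single i (1 : ℝ)) * radialWeight 2 y) = 0 := by
      rw [Finset.mul_sum, Finset.sum_congr rfl fun i _ => hparts _, Finset.sum_neg_distrib,
        ← Finset.mul_sum, ← integral_finsetSum]
      · simp [hzero]
      · exact fun i _ => hint three_ne_zero ((hcd _).comp haff)
    linarith
  · intro i _
    refine (hint two_ne_zero (f := fun y => fderiv ℝ w (x + ρ • y) (EuclideanSpace.single i 1) *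
      inner ℝ y (EuclideanSpace.single i (1 : ℝ))) ?_).congr ?_
    · exact ((hd _).continuous.comp haff).mul (by fun_prop)
    · exact Eventually.of_forall fun y => by dsimp only; ring

/-- Weighted mean value property of harmonic functions. -/
theorem integral_mul_radialWeight_eq {w : EuclideanSpace ℝ (Fin m) → ℝ}
    (hw : ContDiff ℝ 2 w) (hws : HasCompactSupport w) {x : EuclideanSpace ℝ (Fin m)} {R ρ : ℝ}
    (hlap : ∀ z ∈ ball x R, lapl w z = 0) (hρ : 0 ≤ ρ) (hρR : ρ < R) :
    ∫ y : EuclideanSpace ℝ (Fin m), w (x + ρ • y) * radialWeight 2 y =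
      w x * ∫ y : EuclideanSpace ℝ (Fin m), radialWeight 2 y := by
  obtain ⟨C, hC⟩ := (hws.fderiv ℝ).exists_bound_of_continuous
    (hw.continuous_fderiv two_ne_zero)
  have hint : ∀ {f : EuclideanSpace ℝ (Fin m) → ℝ}, Continuous f →
      Integrable fun y => f y * radialWeight 2 y := fun hf =>
    (hf.mul (continuous_radialWeight _)).integrable_of_hasCompactSupport
      (hasCompactSupport_radialWeight two_ne_zero).mul_left
  have hder : ∀ s : ℝ, HasDerivAt
      (fun s : ℝ => ∫ y : EuclideanSpace ℝ (Fin m), w (x + s • y) * radialWeight 2 y)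
      (∫ y : EuclideanSpace ℝ (Fin m), fderiv ℝ w (x + s • y) y * radialWeight 2 y) s := by
    intro s
    refine (hasDerivAt_integral_of_dominated_loc_of_deriv_le (s := univ)
      (F' := fun s y => fderiv ℝ w (x + s • y) y * radialWeight 2 y)
      (bound := fun y : EuclideanSpace ℝ (Fin m) => (C * ‖y‖) * radialWeight 2 y) univ_mem
      (Eventually.of_forall fun s => ?_) ?_ ?_ (Eventually.of_forall fun y s _ => ?_) ?_
      (Eventually.of_forall fun y s _ => ?_)).2
    · exact (hint (hw.continuous.comp (by fun_prop))).aestronglyMeasurable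
    · exact hint (hw.continuous.comp (by fun_prop))
    · exact (hint (((hw.continuous_fderiv two_ne_zero).comp (by fun_prop)).clm_apply
        continuous_id)).aestronglyMeasurable
    · rw [norm_mul, Real.norm_of_nonneg (radialWeight_nonneg 2 y)]
      exact mul_le_mul_of_nonneg_right ((fderiv ℝ w _).le_of_opNorm_le (hC _) y)
        (radialWeight_nonneg 2 y)
    · exact hint (by fun_prop)
    · have h1 : HasDerivAt (fun s : ℝ => x + s • y) y s := by
        simpa using ((hasDerivAt_id s).smul_const y).const_add x
      exact (((hw.differentiable two_ne_zero) _).hasFDerivAt.comp_hasDerivAt s h1).mul_const _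
  have hconst := constant_of_has_deriv_right_zero (a := 0) (b := ρ)
    (f := fun s : ℝ => ∫ y : EuclideanSpace ℝ (Fin m), w (x + s • y) * radialWeight 2 y)
    (fun s _ => (hder s).continuousAt.continuousWithinAt)
    (fun s hs => by
      have := (hder s).hasDerivWithinAt (s := Ici s)
      rwa [integral_fderiv_mul_radialWeight hw hlap hs.1 (hs.2.trans hρR)] at this)
    ρ ⟨hρ, le_rfl⟩
  simpa [integral_const_mul] using hconst

end Euclidean

section Harnack

variable {m : ℕ}

theorem lapl_congr {u v : EuclideanSpace ℝ (Fin m) → ℝ} {x : EuclideanSpace ℝ (Fin m)}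
    (h : u =ᶠ[𝓝 x] v) : lapl u x = lapl v x := by
  refine Finset.sum_congr rfl fun i _ => ?_
  have h' : (fun y => fderiv ℝ u y (EuclideanSpace.single i 1)) =ᶠ[𝓝 x]
      fun y => fderiv ℝ v y (EuclideanSpace.single i 1) := by
    filter_upwards [h.fderiv (𝕜 := ℝ)] with y hy
    rw [hy]
  rw [h'.fderiv_eq]

theorem integral_comp_add_smul_mul_radialWeight (w : EuclideanSpace ℝ (Fin m) → ℝ)
    (x : EuclideanSpace ℝ (Fin m)) {ρ : ℝ} (hρ : 0 < ρ) :
    ∫ z : EuclideanSpace ℝ (Fin m), w z * radialWeight 2 (ρ⁻¹ • (z - x)) =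
      ρ ^ m * ∫ y : EuclideanSpace ℝ (Fin m), w (x + ρ • y) * radialWeight 2 y := by
  have h := Measure.integral_comp_smul (volume : Measure (EuclideanSpace ℝ (Fin m)))
    (fun z => w (x + z) * radialWeight 2 (ρ⁻¹ • z)) ρ
  simp only [inv_smul_smul₀ hρ.ne', finrank_euclideanSpace_fin, smul_eq_mul] at h
  rw [h, abs_of_pos (by positivity), mul_inv_cancel_left₀ (by positivity),
    ← integral_add_left_eq_self _ x]
  simp

theorem mul_radialWeight_le {p x z : EuclideanSpace ℝ (Fin m)} {r : ℝ} (hr : 0 < r)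
    (hx : x ∈ closedBall p (r / 4)) :
    49 / 256 * radialWeight 2 ((r / 4)⁻¹ • (z - p)) ≤
      radialWeight 2 ((2 * r / 3)⁻¹ • (z - x)) := by
  rcases le_or_gt (r / 4) ‖z - p‖ with hz | hz
  · rw [radialWeight_eq_zero two_ne_zero, mul_zero]
    · exact radialWeight_nonneg _ _
    · rwa [norm_smul, norm_inv, Real.norm_of_nonneg (by positivity), inv_mul_eq_div,
        one_le_div (by positivity)]
  · have hzx : ‖z - x‖ ≤ r / 2 := by
      have h1 : ‖x - p‖ ≤ r / 4 := mem_closedBall_iff_norm.mp hx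
      have h2 := norm_sub_le (z - p) (x - p)
      rw [sub_sub_sub_cancel_right] at h2
      linarith
    have hn : ‖(2 * r / 3)⁻¹ • (z - x)‖ ≤ 3 / 4 := by
      rw [norm_smul, norm_inv, Real.norm_of_nonneg (by positivity), inv_mul_eq_div,
        div_le_iff₀ (by positivity)]
      linarith
    have h7 : (7 / 16 : ℝ) ≤ max 0 (1 - ‖(2 * r / 3)⁻¹ • (z - x)‖ ^ 2) :=
      le_max_of_le_right (by nlinarith [norm_nonneg ((2 * r / 3)⁻¹ • (z - x))])
    calc 49 / 256 * radialWeight 2 ((r / 4)⁻¹ • (z - p)) ≤ 49 / 256 * 1 := by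
          gcongr
          exact radialWeight_le_one _ _
      _ = (7 / 16) ^ 2 := by norm_num
      _ ≤ radialWeight 2 ((2 * r / 3)⁻¹ • (z - x)) := by
          unfold radialWeight
          gcongr

theorem harnack_of_hasCompactSupport {w : EuclideanSpace ℝ (Fin m) → ℝ}
    (hw : ContDiff ℝ 2 w) (hws : HasCompactSupport w) (hw0 : ∀ z, 0 ≤ w z)
    {p x : EuclideanSpace ℝ (Fin m)} {r R : ℝ} (hr : 0 < r) (hR : 11 / 12 * r < R)
    (hlap : ∀ z ∈ ball p R, lapl w z = 0) (hx : x ∈ closedBall p (r / 4)) :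
    49 / 256 * (3 / 8) ^ m * w p ≤ w x := by
  have hsub : ball x (R - r / 4) ⊆ ball p R :=
    ball_subset_ball' (by linarith [mem_closedBall.mp hx])
  have hp := integral_mul_radialWeight_eq hw hws hlap (ρ := r / 4) (by positivity) (by linarith)
  have hx' := integral_mul_radialWeight_eq hw hws (fun z hz => hlap z (hsub hz))
    (ρ := 2 * r / 3) (by positivity) (by linarith)
  have hle : ∫ z, w z * (49 / 256 * radialWeight 2 ((r / 4)⁻¹ • (z - p))) ≤
      ∫ z, w z * radialWeight 2 ((2 * r / 3)⁻¹ • (z - x)) := by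
    refine integral_mono_of_nonneg (Eventually.of_forall fun z => ?_) ?_
      (Eventually.of_forall fun z => ?_)
    · exact mul_nonneg (hw0 z) (mul_nonneg (by norm_num) (radialWeight_nonneg _ _))
    · exact (hw.continuous.mul ((continuous_radialWeight 2).comp
        (by fun_prop))).integrable_of_hasCompactSupport hws.mul_right
    · exact mul_le_mul_of_nonneg_left (mul_radialWeight_le hr hx) (hw0 z)
  simp only [mul_left_comm (w _) (49 / 256 : ℝ)] at hle
  rw [integral_const_mul, integral_comp_add_smul_mul_radialWeight w p (by positivity),
    integral_comp_add_smul_mul_radialWeight w x (by positivity), hp, hx'] at hle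
  have hpow : (r / 4) ^ m = (3 / 8) ^ m * (2 * r / 3) ^ m := by
    rw [← mul_pow]
    ring
  rw [hpow] at hle
  have hK : 0 < (2 * r / 3) ^ m * ∫ y : EuclideanSpace ℝ (Fin m), radialWeight 2 y :=
    mul_pos (by positivity) integral_radialWeight_pos
  refine le_of_mul_le_mul_right (le_trans (le_of_eq ?_) (hle.trans (le_of_eq ?_))) hK <;> ring

/-- Harnack inequality on a ball: lower bound by the value at the center. -/
theorem IsHarmonicOn.harnack {u : EuclideanSpace ℝ (Fin m) → ℝ}
    {p x : EuclideanSpace ℝ (Fin m)} {r : ℝ} (hu : IsHarmonicOn u (ball p r))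
    (hu0 : ∀ z ∈ ball p r, 0 ≤ u z) (hr : 0 < r) (hx : x ∈ closedBall p (r / 4)) :
    49 / 256 * (3 / 8) ^ m * u p ≤ u x := by
  let χ : ContDiffBump p := ⟨23 / 24 * r, 47 / 48 * r, by positivity, by linarith⟩
  have hsupp : tsupport χ ⊆ ball p r := by
    rw [χ.tsupport_eq]
    exact closedBall_subset_ball (by change 47 / 48 * r < r; linarith)
  have hone : ∀ z ∈ ball p (23 / 24 * r), χ z = 1 := fun z hz =>
    χ.one_of_mem_closedBall (ball_subset_closedBall hz)
  have hw : ContDiff ℝ 2 fun z => χ z * u z := by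
    refine contDiff_iff_contDiffAt.mpr fun z => ?_
    by_cases hz : z ∈ tsupport χ
    · exact χ.contDiffAt.mul (hu.1.contDiffAt (isOpen_ball.mem_nhds (hsupp hz)))
    · have h0 : (fun z => χ z * u z) =ᶠ[𝓝 z] fun _ => 0 := by
        filter_upwards [notMem_tsupport_iff_eventuallyEq.mp hz] with y hy
        simp [hy]
      exact contDiffAt_const.congr_of_eventuallyEq h0
  have h := harnack_of_hasCompactSupport hw χ.hasCompactSupport.mul_right (fun z => ?_) hr
    (R := 23 / 24 * r) (by linarith) (fun z hz => ?_) hx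
  · rwa [hone p (mem_ball_self (by positivity)), hone x
      (closedBall_subset_ball (by linarith) hx), one_mul, one_mul] at h
  · by_cases hz : z ∈ tsupport χ
    · exact mul_nonneg χ.nonneg (hu0 z (hsupp hz))
    · simp [image_eq_zero_of_notMem_tsupport hz]
  · have heq : (fun z => χ z * u z) =ᶠ[𝓝 z] u := by
      filter_upwards [isOpen_ball.mem_nhds hz] with y hy
      rw [hone y hy, one_mul]
    rw [lapl_congr heq]
    exact hu.2 z (ball_subset_ball (by linarith) hz)

end Harnack

section Comparison

variable {m : ℕ}

theorem ContDiffAt.eventually_differentiableAt {E : Type*} [NormedAddCommGroup E]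
    [NormedSpace ℝ E] {f : E → ℝ} {x : E} (hf : ContDiffAt ℝ 2 f x) :
    ∀ᶠ y in 𝓝 x, DifferentiableAt ℝ f y :=
  (hf.eventually (by simp)).mono fun _ hy => hy.differentiableAt two_ne_zero

theorem ContDiffAt.differentiableAt_fderiv_apply {E : Type*} [NormedAddCommGroup E]
    [NormedSpace ℝ E] {f : E → ℝ} {x : E} (hf : ContDiffAt ℝ 2 f x) (v : E) :
    DifferentiableAt ℝ (fun y => fderiv ℝ f y v) x :=
  (((hf.fderiv_right (m := 1) (by norm_num)).differentiableAt one_ne_zero).clm_apply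
    (differentiableAt_const v))

theorem IsLocalMin.fderiv_fderiv_nonneg {E : Type*} [NormedAddCommGroup E] [NormedSpace ℝ E]
    {f : E → ℝ} {x : E} (hmin : IsLocalMin f x) (hf : ContDiffAt ℝ 2 f x) (v : E) :
    0 ≤ fderiv ℝ (fun y => fderiv ℝ f y v) x v := by
  by_contra! hneg
  have hline : ∀ s : ℝ, HasDerivAt (fun s : ℝ => x + s • v) v s := fun s => by
    simpa using ((hasDerivAt_id s).smul_const v).const_add x
  have hx : x + (0 : ℝ) • v = x := by simp
  have htend : Tendsto (fun s : ℝ => x + s • v) (𝓝 0) (𝓝 x) := by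
    simpa using (hline 0).continuousAt.tendsto
  have hd : deriv (fun s : ℝ => f (x + s • v)) =ᶠ[𝓝 0] fun s => fderiv ℝ f (x + s • v) v := by
    filter_upwards [htend.eventually hf.eventually_differentiableAt] with s hs
    exact (hs.hasFDerivAt.comp_hasDerivAt s (hline s)).deriv
  have hdd : deriv (deriv fun s : ℝ => f (x + s • v)) 0 =
      fderiv ℝ (fun y => fderiv ℝ f y v) x v := by
    rw [hd.deriv_eq]
    have h := hf.differentiableAt_fderiv_apply v
    rw [← hx] at h
    simpa [hx, Function.comp_def] using (h.hasFDerivAt.comp_hasDerivAt 0 (hline 0)).deriv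
  have hmin' : IsLocalMin (fun s : ℝ => f (x + s • v)) 0 := by
    simpa [IsLocalMin, IsMinFilter] using htend.eventually hmin
  have hcont : ContinuousAt (fun s : ℝ => f (x + s • v)) 0 := by
    have h := hf.continuousAt
    rw [← hx] at h
    exact h.comp (f := fun s : ℝ => x + s • v) (hline 0).continuousAt
  have hmax := isLocalMax_of_deriv_deriv_neg (hdd.trans_lt hneg) hmin'.deriv_eq_zero hcont
  have hconst : (fun s : ℝ => f (x + s • v)) =ᶠ[𝓝 0] fun _ => f (x + (0 : ℝ) • v) := by
    filter_upwards [hmin', hmax] with s h1 h2 using le_antisymm h2 h1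
  rw [← hdd, hconst.deriv.deriv_eq] at hneg
  simp at hneg

/-- Weak minimum principle for strict supersolutions. -/
theorem nonneg_of_lapl_neg {f : EuclideanSpace ℝ (Fin m) → ℝ}
    {K : Set (EuclideanSpace ℝ (Fin m))} (hK : IsCompact K) (hf : ContinuousOn f K)
    (h : ∀ x ∈ K, 0 ≤ f x ∨ K ∈ 𝓝 x ∧ ContDiffAt ℝ 2 f x ∧ lapl f x < 0) :
    ∀ x ∈ K, 0 ≤ f x := by
  intro x hx
  obtain ⟨x₀, hx₀, hmin⟩ := hK.exists_isMinOn ⟨x, hx⟩ hf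
  refine le_trans ?_ (hmin hx)
  rcases h x₀ hx₀ with h0 | ⟨hnhds, hcd, hneg⟩
  · exact h0
  · exact absurd hneg (not_lt.mpr (Finset.sum_nonneg fun i _ =>
      (hmin.isLocalMin hnhds).fderiv_fderiv_nonneg hcd _))

theorem lapl_sub_const_mul {u h : EuclideanSpace ℝ (Fin m) → ℝ} {x : EuclideanSpace ℝ (Fin m)}
    (hu : ContDiffAt ℝ 2 u x) (hh : ContDiffAt ℝ 2 h x) (c : ℝ) :
    lapl (fun y => u y - c * h y) x = lapl u x - c * lapl h x := by
  unfold lapl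
  rw [Finset.mul_sum, ← Finset.sum_sub_distrib]
  refine Finset.sum_congr rfl fun i _ => ?_
  have hev : (fun y => fderiv ℝ (fun y => u y - c * h y) y (EuclideanSpace.single i 1)) =ᶠ[𝓝 x]
      fun y => fderiv ℝ u y (EuclideanSpace.single i 1) -
        c * fderiv ℝ h y (EuclideanSpace.single i 1) := by
    filter_upwards [hu.eventually_differentiableAt, hh.eventually_differentiableAt] with y h1 h2
    rw [(h1.hasFDerivAt.fun_sub (h2.hasFDerivAt.const_mul c)).fderiv]
    simp
  rw [hev.fderiv_eq, ((hu.differentiableAt_fderiv_apply _).hasFDerivAt.fun_sub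
    ((hh.differentiableAt_fderiv_apply _).hasFDerivAt.const_mul c)).fderiv]
  simp

/-- The Hopf barrier `exp (-α |x - p|²) - b`. -/
def hopfBarrier (p : EuclideanSpace ℝ (Fin m)) (α b : ℝ) (x : EuclideanSpace ℝ (Fin m)) : ℝ :=
  Real.exp (-α * ‖x - p‖ ^ 2) - b

theorem contDiff_hopfBarrier (p : EuclideanSpace ℝ (Fin m)) (α b : ℝ) :
    ContDiff ℝ 2 (hopfBarrier p α b) :=
  (Real.contDiff_exp.comp (contDiff_const.mul ((contDiff_id.sub contDiff_const).norm_sq ℝ))).sub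
    contDiff_const

theorem lapl_hopfBarrier (p : EuclideanSpace ℝ (Fin m)) (α b : ℝ)
    (x : EuclideanSpace ℝ (Fin m)) :
    lapl (hopfBarrier p α b) x =
      (4 * α ^ 2 * ‖x - p‖ ^ 2 - 2 * α * m) * Real.exp (-α * ‖x - p‖ ^ 2) := by
  have hexp : ∀ y : EuclideanSpace ℝ (Fin m),
      HasFDerivAt (fun y => Real.exp (-α * ‖y - p‖ ^ 2))
        (Real.exp (-α * ‖y - p‖ ^ 2) • (-α) • (2 : ℝ) • innerSL ℝ (y - p)) y := by
    intro y
    have h := ((hasFDerivAt_id (𝕜 := ℝ) y).sub_const p).norm_sq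
    refine (h.const_mul (-α)).exp.congr_fderiv ?_
    ext z
    simp
  have hfst : ∀ (i : Fin m) (y : EuclideanSpace ℝ (Fin m)),
      fderiv ℝ (hopfBarrier p α b) y (EuclideanSpace.single i 1) =
        -2 * α * (Real.exp (-α * ‖y - p‖ ^ 2) *
          innerSL ℝ (EuclideanSpace.single i (1 : ℝ)) (y - p)) := by
    intro i y
    rw [show hopfBarrier p α b = fun y => Real.exp (-α * ‖y - p‖ ^ 2) - b from rfl,
      ((hexp y).sub_const b).fderiv]
    simp [EuclideanSpace.inner_single_left, EuclideanSpace.inner_single_right]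
    ring
  have hsnd : ∀ i : Fin m, fderiv ℝ (fun y => fderiv ℝ (hopfBarrier p α b) y
      (EuclideanSpace.single i 1)) x (EuclideanSpace.single i 1) =
      (4 * α ^ 2 * (x - p) i ^ 2 - 2 * α) * Real.exp (-α * ‖x - p‖ ^ 2) := by
    intro i
    simp only [hfst]
    have hlin : HasFDerivAt (fun y => innerSL ℝ (EuclideanSpace.single i (1 : ℝ)) (y - p))
        (innerSL ℝ (EuclideanSpace.single i (1 : ℝ))) x :=
      (innerSL ℝ (EuclideanSpace.single i (1 : ℝ))).hasFDerivAt.comp x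
        ((hasFDerivAt_id x).sub_const p)
    rw [(((hexp x).fun_mul hlin).const_mul (-2 * α)).fderiv]
    simp [EuclideanSpace.inner_single_left, EuclideanSpace.inner_single_right]
    ring
  rw [lapl, Finset.sum_congr rfl fun i _ => hsnd i, ← Finset.sum_mul, Finset.sum_sub_distrib,
    ← Finset.mul_sum, ← EuclideanSpace.real_norm_sq_eq]
  simp
  ring

/-- Boundary growth of a nonnegative harmonic function on a ball. -/
theorem IsHarmonicOn.le_of_mem_annulus {u : EuclideanSpace ℝ (Fin m) → ℝ}
    {p : EuclideanSpace ℝ (Fin m)} {r c α : ℝ} (hr : 0 < r) (hc : 0 < c) (hα : 0 < α)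
    (hαr : 8 * m < α * r ^ 2) (hu : IsHarmonicOn u (ball p r))
    (hcont : ContinuousOn u (closedBall p r)) (hu0 : ∀ z ∈ closedBall p r, 0 ≤ u z)
    (huc : ∀ z ∈ closedBall p (r / 4), c ≤ u z) {x : EuclideanSpace ℝ (Fin m)}
    (hx : x ∈ closedBall p r) (hx' : x ∉ ball p (r / 4)) :
    c * hopfBarrier p α (Real.exp (-α * r ^ 2)) x ≤ u x := by
  set h := hopfBarrier p α (Real.exp (-α * r ^ 2)) with hh
  refine sub_nonneg.mp (nonneg_of_lapl_neg (f := fun y => u y - c * h y)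
    (K := closedBall p r \ ball p (r / 4)) ((isCompact_closedBall p r).diff isOpen_ball)
    ((hcont.mono sdiff_subset).sub
      (((contDiff_hopfBarrier p α _).continuous.continuousOn).const_smul c)) ?_ x ⟨hx, hx'⟩)
  rintro y ⟨hy, hy'⟩
  have hyr : ‖y - p‖ ≤ r := mem_closedBall_iff_norm.mp hy
  have hyr' : r / 4 ≤ ‖y - p‖ := not_lt.mp fun hlt => hy' (mem_ball_iff_norm.mpr hlt)
  rcases hyr.eq_or_lt with heq | hlt
  · left
    simp [hh, hopfBarrier, heq, hu0 y hy]
  rcases hyr'.eq_or_lt with heq | hlt'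
  · left
    have h1 := huc y (mem_closedBall_iff_norm.mpr heq.ge)
    have h2 : h y ≤ 1 := by
      have : Real.exp (-α * ‖y - p‖ ^ 2) ≤ 1 :=
        Real.exp_le_one_iff.mpr (by nlinarith [sq_nonneg ‖y - p‖])
      simp only [hh, hopfBarrier]
      linarith [Real.exp_pos (-α * r ^ 2)]
    nlinarith
  · right
    have hyb : y ∈ ball p r := mem_ball_iff_norm.mpr hlt
    have hucd := hu.1.contDiffAt (isOpen_ball.mem_nhds hyb)
    have hhcd := (contDiff_hopfBarrier p α (Real.exp (-α * r ^ 2))).contDiffAt (x := y)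
    refine ⟨?_, hucd.sub (contDiffAt_const.mul hhcd), ?_⟩
    · have hopen : IsOpen (ball p r \ closedBall p (r / 4)) := isOpen_ball.sdiff isClosed_closedBall
      refine mem_of_superset (hopen.mem_nhds ⟨hyb, fun hm => ?_⟩)
        (sdiff_subset_sdiff ball_subset_closedBall ball_subset_closedBall)
      exact hlt'.not_ge (mem_closedBall_iff_norm.mp hm)
    · rw [lapl_sub_const_mul hucd hhcd, hu.2 y hyb, lapl_hopfBarrier, zero_sub, neg_lt_zero]
      refine mul_pos hc (mul_pos ?_ (Real.exp_pos _))
      have hsq : r ^ 2 / 16 ≤ ‖y - p‖ ^ 2 := by nlinarith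
      have h3 : 2 * m < 4 * α * ‖y - p‖ ^ 2 := by nlinarith
      nlinarith

end Comparison

theorem hopf_lemma_interior_sphere (n : ℕ) (r₀ : ℝ) (hr₀ : 0 < r₀) (hr₀' : r₀ < 1 / 2) :
    ∃ C : ℝ, 0 < C ∧
      ∀ (Ω : Set (EuclideanSpace ℝ (Fin (n + 2)))) (u : EuclideanSpace ℝ (Fin (n + 2)) → ℝ),
        IsOpen Ω → (0 : EuclideanSpace ℝ (Fin (n + 2))) ∈ frontier Ω →
        Metric.ball (r₀ • en n) r₀ ⊆ Ω →
        ContinuousOn u ((Ω ∩ Metric.ball 0 1) ∪ (frontier Ω ∩ Metric.ball 0 1)) →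
        IsHarmonicOn u (Ω ∩ Metric.ball 0 1) →
        (∀ x ∈ Ω ∩ Metric.ball 0 1, 0 ≤ u x) →
        (∀ x ∈ frontier Ω ∩ Metric.ball 0 1, u x = 0) →
        u (r₀ • en n) = 1 →
        ∀ t : ℝ, 0 < t → t < r₀ / 2 → C * t ≤ u (t • en n) := by
  have hnorm : ‖en n‖ = 1 := by simp [en]
  set p := r₀ • en n with hp
  set c : ℝ := 49 / 256 * (3 / 8) ^ (n + 2)
  set α : ℝ := 16 * (n + 2) / r₀ ^ 2
  have hc : 0 < c := by positivity
  have hα : 0 < α := by positivity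
  have hpn : ‖p‖ = r₀ := by rw [hp, norm_smul, hnorm, Real.norm_of_nonneg hr₀.le, mul_one]
  refine ⟨c * (Real.exp (-α * r₀ ^ 2) * (α * r₀)), by positivity, ?_⟩
  intro Ω u _ _ hball hcont hharm hnn hzero hone t ht htr
  have hunit : closedBall p r₀ ⊆ ball 0 1 :=
    closedBall_subset_ball' (by rw [dist_zero_right, hpn]; linarith)
  have hsub : ball p r₀ ⊆ Ω ∩ ball 0 1 :=
    subset_inter hball (ball_subset_closedBall.trans hunit)
  have hclosed : closedBall p r₀ ⊆ (Ω ∩ ball 0 1) ∪ (frontier Ω ∩ ball 0 1) := by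
    intro z hz
    have hzc : z ∈ closure Ω := closure_mono hball (by rwa [closure_ball p hr₀.ne'])
    rw [← union_inter_distrib_right, ← closure_eq_self_union_frontier]
    exact ⟨hzc, hunit hz⟩
  have hu : IsHarmonicOn u (ball p r₀) := ⟨hharm.1.mono hsub, fun z hz => hharm.2 z (hsub hz)⟩
  have hu0 : ∀ z ∈ closedBall p r₀, 0 ≤ u z := fun z hz =>
    (hclosed hz).elim (hnn z) fun h => (hzero z h).ge
  have huc : ∀ z ∈ closedBall p (r₀ / 4), c ≤ u z := fun z hz => by
    simpa [hone] using hu.harnack (fun y hy => hu0 y (ball_subset_closedBall hy)) hr₀ hz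
  have hdist : ‖t • en n - p‖ = r₀ - t := by
    rw [hp, ← sub_smul, norm_smul, hnorm, mul_one, Real.norm_of_nonpos (by linarith), neg_sub]
  have hαr : 8 * ((n + 2 : ℕ) : ℝ) < α * r₀ ^ 2 := by
    rw [div_mul_cancel₀ _ (by positivity)]
    push_cast
    linarith [(n.cast_nonneg : (0 : ℝ) ≤ n)]
  refine le_trans ?_ (hu.le_of_mem_annulus hr₀ hc hα hαr (hcont.mono hclosed) hu0 huc
    (x := t • en n) (mem_closedBall_iff_norm.mpr (by linarith))
    (fun hm => by linarith [mem_ball_iff_norm.mp hm]))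
  rw [mul_assoc]
  refine mul_le_mul_of_nonneg_left ?_ hc.le
  have hsplit : Real.exp (-α * (r₀ - t) ^ 2) =
      Real.exp (-α * r₀ ^ 2) * Real.exp (α * (t * (2 * r₀ - t))) := by
    rw [← Real.exp_add]
    ring_nf
  rw [hopfBarrier, hdist, hsplit]
  have hexp := Real.add_one_le_exp (α * (t * (2 * r₀ - t)))
  have hlow : α * r₀ * t ≤ α * (t * (2 * r₀ - t)) := by
    rw [mul_assoc]
    exact mul_le_mul_of_nonneg_left (by nlinarith) hα.le
  nlinarith [Real.exp_pos (-α * r₀ ^ 2)]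
end
end
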